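/- arXiv:math/0205289 — 2 statements merged into one kernel-verified Lean document; each statement's English description precedes it below -/
import Mathlib

section
/- Let D be a quaternion division algebra over ℚ. If D ⊗_ℚ ℚ_p is not a division algebra (i.e., D splits at every odd prime p), then D ⊗_ℚ ℝ is a division algebra (D does not split over ℝ); equivalently D ⊗_ℚ ℝ ≅ ℍ, the Hamilton quaternions. -/
open TensorProduct

/-- The conic `z² = a x² + b y²` has a nontrivial point over `K`. -/
def HasConicPoint (K : Type*) [Field K] (a b : K) : Prop :=
  ∃ x y z : K, ¬(x = 0 ∧ y = 0 ∧ z = 0) ∧ z ^ 2 = a * x ^ 2 + b * y ^ 2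

namespace HasConicPoint

section Field

variable {K : Type*} [Field K] {a b : K}

theorem symm (h : HasConicPoint K a b) : HasConicPoint K b a := by
  obtain ⟨x, y, z, h0, h⟩ := h
  exact ⟨y, x, z, by tauto, by rw [h]; ring⟩

theorem of_sq_mul {c : K} (hc : c ≠ 0) (h : HasConicPoint K a (c ^ 2 * b)) :
    HasConicPoint K a b := by
  obtain ⟨x, y, z, h0, h⟩ := h
  refine ⟨x, c * y, z, ?_, by rw [h]; ring⟩
  simpa [hc] using h0

theorem sq_mul {c : K} (hc : c ≠ 0) (h : HasConicPoint K a b) :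
    HasConicPoint K a (c ^ 2 * b) := by
  apply of_sq_mul (inv_ne_zero hc)
  convert h using 1
  field_simp

theorem of_eq_sq {t : K} (h : a = t ^ 2) : HasConicPoint K a b :=
  ⟨1, 0, t, by simp, by rw [h]; ring⟩

/-- If `b * b'` is a norm from `K(√a)`, a point for `(a, b)` yields one for `(a, b')`. -/
theorem of_mul_eq {b' t : K} (hb : b ≠ 0) (ht : b * b' = t ^ 2 - a)
    (h : HasConicPoint K a b) : HasConicPoint K a b' := by
  obtain ⟨x, y, z, h0, h⟩ := h
  by_cases hy : y = 0
  · subst hy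
    exact ⟨x, 0, z, h0, by rw [h]; ring⟩
  · refine ⟨z + t * x, b * y, z * t + a * x, by simp [hb, hy], ?_⟩
    linear_combination (t ^ 2 - a) * h - b * y ^ 2 * ht

end Field

/-- A nontrivial point can be scaled so that all coordinates are integral and one of them is `1`. -/
theorem exists_padicInt {p : ℕ} [Fact p.Prime] {a b : ℤ}
    (h : HasConicPoint ℚ_[p] (a : ℚ_[p]) (b : ℚ_[p])) :
    ∃ x y z : ℤ_[p], (x = 1 ∨ y = 1 ∨ z = 1) ∧ z ^ 2 = a * x ^ 2 + b * y ^ 2 := by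
  obtain ⟨x, y, z, h0, h⟩ := h
  have key : ∃ m : ℚ_[p], m ≠ 0 ∧ (x = m ∨ y = m ∨ z = m) ∧ ‖x‖ ≤ ‖m‖ ∧ ‖y‖ ≤ ‖m‖ ∧ ‖z‖ ≤ ‖m‖ := by
    classical
    obtain ⟨m, hm, hle⟩ := Finset.exists_max_image ({x, y, z} : Finset ℚ_[p])
      (fun t : ℚ_[p] => ‖t‖) (by simp)
    simp only [Finset.mem_insert, Finset.mem_singleton, forall_eq_or_imp, forall_eq] at hm hle
    refine ⟨m, ?_, by tauto, hle⟩
    rintro rfl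
    simp only [norm_zero, norm_le_zero_iff] at hle
    exact h0 hle
  obtain ⟨m, hm, hmem, hx, hy, hz⟩ := key
  have hle : ∀ {t : ℚ_[p]}, ‖t‖ ≤ ‖m‖ → ‖t / m‖ ≤ 1 := fun ht => by
    rw [norm_div]
    exact div_le_one_of_le₀ ht (norm_nonneg _)
  refine ⟨⟨x / m, hle hx⟩, ⟨y / m, hle hy⟩, ⟨z / m, hle hz⟩, ?_, ?_⟩
  · rcases hmem with rfl | rfl | rfl
    · exact .inl (Subtype.ext (div_self hm))
    · exact .inr (.inl (Subtype.ext (div_self hm)))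
    · exact .inr (.inr (Subtype.ext (div_self hm)))
  · apply Subtype.ext
    change (z / m) ^ 2 = ((a : ℤ_[p]) : ℚ_[p]) * (x / m) ^ 2 + ((b : ℤ_[p]) : ℚ_[p]) * (y / m) ^ 2
    rw [PadicInt.coe_intCast, PadicInt.coe_intCast, div_pow, h]
    ring

theorem isSquare_zmod {p : ℕ} [Fact p.Prime] {a b : ℤ} (hb : Squarefree b)
    (hpb : (p : ℤ) ∣ b) (h : HasConicPoint ℚ_[p] (a : ℚ_[p]) (b : ℚ_[p])) :
    IsSquare (a : ZMod p) := by
  obtain ⟨x, y, z, h1, h⟩ := h.exists_padicInt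
  have hbz : (b : ZMod p) = 0 := (ZMod.intCast_zmod_eq_zero_iff_dvd b p).mpr hpb
  have hmod : (PadicInt.toZMod z) ^ 2 = a * (PadicInt.toZMod x) ^ 2 := by
    simpa [hbz] using congrArg PadicInt.toZMod h
  by_cases hx : PadicInt.toZMod x = 0
  · have hz : PadicInt.toZMod z = 0 := by simpa [hx] using hmod
    have hdvd : ∀ {t : ℤ_[p]}, PadicInt.toZMod t = 0 ↔ (p : ℤ_[p]) ∣ t := fun {t} => by
      rw [← RingHom.mem_ker, PadicInt.ker_toZMod, PadicInt.maximalIdeal_eq_span_p,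
        Ideal.mem_span_singleton]
    exfalso
    obtain ⟨c, rfl⟩ := hpb
    have hpc : ¬ (p : ℤ) ∣ c := fun ⟨d, hd⟩ => by
      have := hb p ⟨d, by rw [hd]; ring⟩
      exact (Nat.prime_iff_prime_int.mp (Fact.out : p.Prime)).not_isUnit this
    have hcz : (c : ZMod p) ≠ 0 := by rwa [Ne, ZMod.intCast_zmod_eq_zero_iff_dvd]
    obtain ⟨x', hx'⟩ := hdvd.mp hx
    obtain ⟨z', hz'⟩ := hdvd.mp hz
    have hp0 : (p : ℤ_[p]) ≠ 0 := by exact_mod_cast (Fact.out : p.Prime).ne_zero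
    have hcy : (c : ℤ_[p]) * y ^ 2 = p * (z' ^ 2 - a * x' ^ 2) := by
      apply mul_left_cancel₀ hp0
      rw [hx', hz'] at h
      push_cast at h
      linear_combination -h
    have hy : PadicInt.toZMod y = 0 := by
      have := congrArg PadicInt.toZMod hcy
      simpa [hcz] using this
    rcases h1 with rfl | rfl | rfl
    · simp at hx
    · simp at hy
    · simp at hz
  · refine ⟨PadicInt.toZMod z / PadicInt.toZMod x, ?_⟩
    field_simp
    exact hmod.symm

end HasConicPoint

theorem ZMod.isSquare_of_coprime_mul {m n : ℕ} (h : m.Coprime n) {a : ℤ}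
    (hm : IsSquare (a : ZMod m)) (hn : IsSquare (a : ZMod n)) : IsSquare (a : ZMod (m * n)) := by
  have : IsSquare (ZMod.chineseRemainder h (a : ZMod (m * n))) := by
    obtain ⟨r, hr⟩ := hm
    obtain ⟨s, hs⟩ := hn
    exact ⟨(r, s), by rw [map_intCast]; exact Prod.ext hr hs⟩
  simpa using this.map (ZMod.chineseRemainder h).symm

theorem ZMod.isSquare_of_squarefree {n : ℕ} (hn : Squarefree n) {a : ℤ}
    (h : ∀ p : ℕ, p.Prime → p ∣ n → IsSquare (a : ZMod p)) : IsSquare (a : ZMod n) := by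
  induction n using induction_on_primes with
  | zero => exact absurd hn not_squarefree_zero
  | one => exact ⟨0, Subsingleton.elim _ _⟩
  | prime_mul p m hp ih =>
    exact ZMod.isSquare_of_coprime_mul (Nat.coprime_of_squarefree_mul hn)
      (h p hp (dvd_mul_right _ _))
      (ih hn.of_mul_right fun q hq hqm => h q hq (hqm.mul_left _))

theorem Int.exists_sq_mul_squarefree {n : ℤ} (hn : n ≠ 0) :
    ∃ c m : ℤ, c ≠ 0 ∧ n = c ^ 2 * m ∧ Squarefree m := by
  obtain ⟨m, c, hmc, hm⟩ := Nat.sq_mul_squarefree n.natAbs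
  refine ⟨c, n.sign * m, ?_, ?_, ?_⟩
  · rintro h
    simp only [Nat.cast_eq_zero] at h
    subst h
    simp at hmc
    exact hn (Int.natAbs_eq_zero.mp hmc.symm)
  · conv_lhs => rw [← Int.sign_mul_natAbs n, ← hmc]
    push_cast
    ring
  · rw [← Int.squarefree_natAbs, Int.natAbs_mul, Int.natAbs_sign_of_ne_zero hn]
    simpa using hm

/-- Legendre's theorem: for squarefree coefficients, points over `ℝ` and over `ℚ_p` for all odd
`p` suffice for a rational point. -/
theorem hasConicPoint_rat_of_squarefree (a b : ℤ) (ha : Squarefree a) (hb : Squarefree b)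
    (hreal : HasConicPoint ℝ (a : ℝ) (b : ℝ))
    (hloc : ∀ (p : ℕ) [Fact p.Prime], p ≠ 2 → HasConicPoint ℚ_[p] (a : ℚ_[p]) (b : ℚ_[p])) :
    HasConicPoint ℚ (a : ℚ) (b : ℚ) := by
  induction hN : a.natAbs + b.natAbs using Nat.strong_induction_on generalizing a b with
  | _ N ih =>
  wlog hab : a.natAbs ≤ b.natAbs generalizing a b
  · exact (this b a hb ha hreal.symm (fun p _ hp => (hloc p hp).symm) (by omega) (by omega)).symm
  have ha0 := ha.ne_zero
  have hb0 := hb.ne_zero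
  rcases Nat.lt_or_ge b.natAbs 2 with hb2 | hb2
  · have ha1 : a = 1 ∨ a = -1 := by omega
    have hb1 : b = 1 ∨ b = -1 := by omega
    rcases ha1 with rfl | rfl
    · exact .of_eq_sq (t := 1) (by norm_num)
    rcases hb1 with rfl | rfl
    · exact (HasConicPoint.of_eq_sq (t := 1) (by norm_num)).symm
    obtain ⟨x, y, z, h0, h⟩ := hreal
    push_cast at h
    refine absurd ⟨?_, ?_, ?_⟩ h0 <;> rw [← sq_eq_zero_iff] <;>
      nlinarith [sq_nonneg x, sq_nonneg y, sq_nonneg z]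
  have hsq : IsSquare (a : ZMod b.natAbs) := by
    refine ZMod.isSquare_of_squarefree (Int.squarefree_natAbs.mpr hb) fun p hp hpb => ?_
    have : Fact p.Prime := ⟨hp⟩
    rcases eq_or_ne p 2 with rfl | hp2
    · exact FiniteField.isSquare_of_char_two (ZMod.ringChar_zmod_n 2) _
    · exact (hloc p hp2).isSquare_zmod hb (Int.natCast_dvd.mpr hpb)
  obtain ⟨s, hs⟩ := hsq
  have : NeZero b.natAbs := ⟨by omega⟩
  obtain ⟨t, ht, b', hb'⟩ : ∃ t : ℤ, t.natAbs ≤ b.natAbs / 2 ∧ b ∣ t ^ 2 - a := by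
    refine ⟨s.valMinAbs, ZMod.natAbs_valMinAbs_le s, ?_⟩
    rw [← Int.natAbs_dvd, ← ZMod.intCast_zmod_eq_zero_iff_dvd]
    push_cast
    simp [hs, sq]
  have cast_eq : ∀ (K : Type) [Field K], (b : K) * (b' : K) = (t : K) ^ 2 - (a : K) := by
    intro K _
    exact_mod_cast congrArg (Int.cast : ℤ → K) hb'.symm
  rcases eq_or_ne b' 0 with rfl | hb'0
  · exact .of_eq_sq (t := t) (by have := cast_eq ℚ; push_cast at this; linear_combination this)
  obtain ⟨c, d, hc, hcd, hd⟩ := Int.exists_sq_mul_squarefree hb'0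
  have descend : ∀ (K : Type) [Field K] [CharZero K],
      HasConicPoint K (a : K) (b : K) → HasConicPoint K (a : K) (d : K) := by
    intro K _ _ h
    have h' := h.of_mul_eq (by exact_mod_cast hb0) (cast_eq K)
    rw [hcd] at h'
    push_cast at h'
    exact h'.of_sq_mul (by exact_mod_cast hc)
  have hlt : d.natAbs < b.natAbs := by
    have h1 : |b| * |b'| ≤ t ^ 2 + |a| := by
      rw [← abs_mul, ← hb']
      calc |t ^ 2 - a| ≤ |t ^ 2| + |a| := abs_sub _ _
        _ = t ^ 2 + |a| := by rw [abs_of_nonneg (sq_nonneg t)]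
    have h2 : 2 * |t| ≤ |b| := by rw [Int.abs_eq_natAbs, Int.abs_eq_natAbs]; omega
    have h3 : |a| ≤ |b| := by rw [Int.abs_eq_natAbs, Int.abs_eq_natAbs]; omega
    have h4 : 2 ≤ |b| := by rw [Int.abs_eq_natAbs]; omega
    have h5 : |d| ≤ |b'| := by
      rw [hcd, abs_mul]
      have : 1 ≤ |c ^ 2| := Int.one_le_abs (pow_ne_zero 2 hc)
      nlinarith [abs_nonneg d]
    have h6 : 4 * t ^ 2 ≤ |b| ^ 2 := by
      rw [← sq_abs t]
      nlinarith [abs_nonneg t]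
    have h7 : |b'| < |b| := by
      by_contra! hcon
      nlinarith
    have h8 := h5.trans_lt h7
    rw [Int.abs_eq_natAbs, Int.abs_eq_natAbs] at h8
    exact_mod_cast h8
  have hrat := ih _ (by omega) a d ha hd (descend ℝ hreal)
    (fun p _ hp => descend ℚ_[p] (hloc p hp)) rfl
  refine HasConicPoint.of_mul_eq (b := (b' : ℚ)) (t := (t : ℚ)) (by exact_mod_cast hb'0)
    (by rw [mul_comm]; exact cast_eq ℚ) ?_
  rw [hcd]
  push_cast
  exact hrat.sq_mul (by exact_mod_cast hc)

section QuaternionBasis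

open Quaternion

variable {K A : Type*} [Field K] [Ring A] [Algebra K A] {a b : K}

/-- In a nontrivial algebra over a field of characteristic not two, the elements `1, i, j, k` of a
quaternion basis are linearly independent. -/
theorem QuaternionAlgebra.Basis.liftHom_injective [NeZero (2 : K)] [Nontrivial A]
    (q : QuaternionAlgebra.Basis A a 0 b) (ha : a ≠ 0) (hb : b ≠ 0) :
    Function.Injective q.liftHom := by
  have h2 : (2 : K) ≠ 0 := NeZero.ne 2
  have aux : ∀ r s : K, r • (1 : A) + s • q.i = 0 → r = 0 ∧ s = 0 := by
    intro r s h
    have hj : r • q.j - s • q.k = 0 := by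
      have := congrArg (q.j * ·) h
      simpa [mul_add, sub_eq_add_neg] using this
    have hj' : r • q.j + s • q.k = 0 := by
      have := congrArg (· * q.j) h
      simpa [add_mul] using this
    have hr : (2 * r * b) • (1 : A) = 0 := by
      have h3 : (2 * r) • q.j = 0 := by linear_combination (norm := module) hj + hj'
      have := congrArg (q.j * ·) h3
      simpa [smul_smul] using this
    have hr0 : r = 0 := by simpa [h2, hb] using hr
    subst hr0
    have hs : (s * a) • (1 : A) = 0 := by
      have := congrArg (q.i * ·) h
      simpa [smul_smul] using this
    exact ⟨rfl, by simpa [ha] using hs⟩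
  rw [injective_iff_map_eq_zero]
  intro x hx
  have hx' : x.re • (1 : A) + x.imI • q.i + x.imJ • q.j + x.imK • q.k = 0 := by
    simpa [QuaternionAlgebra.Basis.lift, Algebra.algebraMap_eq_smul_one] using hx
  have hconj : (x.re * a) • (1 : A) + (x.imI * a) • q.i - (x.imJ * a) • q.j
      - (x.imK * a) • q.k = 0 := by
    have := congrArg (q.i * · * q.i) hx'
    simp [mul_add, add_mul, smul_smul] at this
    linear_combination (norm := module) this
  have h1 := aux (2 * a * x.re) (2 * a * x.imI) (by
    linear_combination (norm := module) a • hx' + hconj)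
  have h3 : (2 * a * x.imJ) • q.j + (2 * a * x.imK) • q.k = 0 := by
    linear_combination (norm := module) a • hx' - hconj
  have h4 := aux (2 * a * x.imJ * b) (2 * a * x.imK * b) (by
    have := congrArg (· * q.j) h3
    simpa [add_mul, smul_smul] using this)
  have h2a : 2 * a ≠ 0 := mul_ne_zero h2 ha
  simp only [mul_eq_zero, h2a, hb, false_or, or_false] at h1 h4
  exact QuaternionAlgebra.ext h1.1 h1.2 h4.1 h4.2

/-- A quaternion basis of a four-dimensional algebra identifies it with a quaternion algebra. -/
noncomputable def QuaternionAlgebra.Basis.equivOfFinrank [NeZero (2 : K)]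
    (q : QuaternionAlgebra.Basis A a 0 b) (ha : a ≠ 0) (hb : b ≠ 0)
    (hA : Module.finrank K A = 4) : ℍ[K, a, b] ≃ₐ[K] A :=
  haveI : Nontrivial A := Module.nontrivial_of_finrank_pos (R := K) (by omega)
  haveI : FiniteDimensional K A := Module.finite_of_finrank_pos (by omega)
  AlgEquiv.ofBijective q.liftHom ⟨q.liftHom_injective ha hb,
    (LinearMap.injective_iff_surjective_of_finrank_eq_finrank (f := q.liftHom.toLinearMap)
      (by rw [QuaternionAlgebra.finrank_eq_four, hA])).mp (q.liftHom_injective ha hb)⟩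

theorem QuaternionAlgebra.hasConicPoint_of_not_isUnit [NeZero (2 : K)] (x : ℍ[K, a, b])
    (hx : x ≠ 0) (hu : ¬ IsUnit x) : HasConicPoint K a b := by
  obtain ⟨p, q, r, s⟩ := x
  have hN : p ^ 2 - a * q ^ 2 = b * (r ^ 2 - a * s ^ 2) := by
    by_contra hne
    set n := p ^ 2 - a * q ^ 2 - b * (r ^ 2 - a * s ^ 2) with hn
    have hn0 : n ≠ 0 := sub_ne_zero.mpr hne
    apply hu
    refine isUnit_iff_exists.mpr ⟨⟨p / n, -q / n, -r / n, -s / n⟩, ?_, ?_⟩ <;>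
      ext <;> simp <;> field_simp <;> rw [hn] <;> ring
  by_cases hrs : r ^ 2 - a * s ^ 2 = 0
  · by_cases h0 : s = 0 ∧ r = 0
    · refine ⟨q, 0, p, ?_, by linear_combination hN + b * hrs⟩
      rintro ⟨rfl, -, rfl⟩
      obtain ⟨rfl, rfl⟩ := h0
      exact hx rfl
    · exact ⟨s, 0, r, by tauto, by linear_combination hrs⟩
  · exact ⟨p * s + q * r, r ^ 2 - a * s ^ 2, p * r + a * q * s, by tauto,
      by linear_combination (r ^ 2 - a * s ^ 2) * hN⟩

theorem QuaternionAlgebra.Basis.not_hasConicPoint [NeZero (2 : K)] [IsDomain A]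
    (q : QuaternionAlgebra.Basis A a 0 b) (ha : a ≠ 0) (hb : b ≠ 0) :
    ¬ HasConicPoint K a b := by
  rintro ⟨x, y, z, h0, h⟩
  have hinj := q.liftHom_injective ha hb
  have hmul : (⟨z, x, y, 0⟩ : ℍ[K, a, b]) * ⟨z, -x, -y, 0⟩ = 0 := by
    ext <;> simp
    · linear_combination h
    all_goals ring
  have hmul' := congrArg q.liftHom hmul
  rw [map_mul, map_zero, mul_eq_zero, map_eq_zero_iff _ hinj, map_eq_zero_iff _ hinj] at hmul'
  apply h0
  rcases hmul' with h | h <;> simpa [QuaternionAlgebra.ext_iff, and_comm, and_assoc] using h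

end QuaternionBasis

section DivisionRing

variable {F D : Type*} [Field F] [DivisionRing D] [Algebra F D]

theorem exists_sq_eq_of_finrank_eq_four [NeZero (2 : F)] (hdim : Module.finrank F D = 4)
    (hcentral : Subalgebra.center F D = ⊥) :
    ∃ (i : D) (a : F), i ∉ Subalgebra.center F D ∧ i * i = algebraMap F D a := by
  have : FiniteDimensional F D := Module.finite_of_finrank_pos (by omega)
  have h2 : (2 : F) ≠ 0 := NeZero.ne 2
  obtain ⟨x, hx⟩ : ∃ x : D, x ∉ (⊥ : Subalgebra F D) := by
    by_contra! hall
    have htop : (⊥ : Subalgebra F D) = ⊤ := top_unique fun x _ => hall x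
    have := Subalgebra.bot_eq_top_iff_finrank_eq_one.mp htop
    omega
  let E := Algebra.adjoin F {x}
  have hxE : x ∈ E := Algebra.self_mem_adjoin_singleton F x
  have hmul : Module.finrank F E * Module.finrank E D = 4 := by
    let : DivisionRing E := divisionRingOfFiniteDimensional F E
    have : Module.Free E D := Module.Free.of_divisionRing E D
    rw [Module.finrank_mul_finrank, hdim]
  have hE1 : Module.finrank F E ≠ 1 := fun h =>
    hx (Subalgebra.eq_bot_of_finrank_one h ▸ hxE)
  have hE4 : Module.finrank F E ≠ 4 := fun h => by
    have htop : E = ⊤ := by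
      apply Subalgebra.toSubmodule_injective
      exact Submodule.eq_top_of_finrank_eq (h.trans hdim.symm)
    refine hx (hcentral ▸ Subalgebra.mem_center_iff.mpr fun y => ?_)
    have hy : y ∈ E := htop ▸ Algebra.mem_top
    exact (Algebra.commute_of_mem_adjoin_self (R := F) hy).symm
  have hE2 : Module.finrank F E = 2 := by
    have hle : Module.finrank F E ∣ 4 := ⟨_, hmul.symm⟩
    have := Nat.le_of_dvd (by omega) hle
    interval_cases Module.finrank F E <;> omega
  have hli : LinearIndependent F ![(1 : E), ⟨x, hxE⟩] := by
    rw [LinearIndependent.pair_iff' one_ne_zero]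
    intro c hc
    apply hx
    rw [Algebra.mem_bot]
    exact ⟨c, by rw [Algebra.algebraMap_eq_smul_one]; exact congrArg Subtype.val hc⟩
  have hspan := hli.span_eq_top_of_card_eq_finrank (by simp [hE2])
  have hmem : (⟨x, hxE⟩ * ⟨x, hxE⟩ : E) ∈ Submodule.span F (Set.range ![(1 : E), ⟨x, hxE⟩]) :=
    hspan ▸ Submodule.mem_top
  rw [Matrix.range_cons, Matrix.range_cons, Matrix.range_empty, Set.union_empty,
    Set.singleton_union, Submodule.mem_span_pair] at hmem
  obtain ⟨s, t, hst⟩ := hmem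
  have hst' : s • (1 : D) + t • x = x * x := congrArg Subtype.val hst
  refine ⟨x - (t / 2) • 1, s + t ^ 2 / 4, ?_, ?_⟩
  · rw [hcentral]
    intro hmem
    apply hx
    have := add_mem hmem ((⊥ : Subalgebra F D).smul_mem (one_mem _) (t / 2))
    simpa using this
  · rw [Algebra.algebraMap_eq_smul_one]
    simp only [sub_mul, mul_sub, smul_mul_assoc, mul_smul_comm, one_mul, mul_one, ← hst']
    have h4 : (4 : F) = 2 * 2 := by norm_num
    rw [h4]
    match_scalars <;> field_simp <;> ring

/-- A four-dimensional central division algebra contains a quaternion basis. -/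
theorem exists_quaternionBasis_of_finrank_eq_four [NeZero (2 : F)]
    (hdim : Module.finrank F D = 4) (hcentral : Subalgebra.center F D = ⊥) :
    ∃ a b : F, a ≠ 0 ∧ b ≠ 0 ∧ Nonempty (QuaternionAlgebra.Basis D a 0 b) := by
  obtain ⟨i, a, hi, hia⟩ := exists_sq_eq_of_finrank_eq_four hdim hcentral
  obtain ⟨d, hd⟩ : ∃ d, d * i ≠ i * d := by
    by_contra! h
    exact hi (Subalgebra.mem_center_iff.mpr h)
  have hi0 : i ≠ 0 := by rintro rfl; simp at hd
  have ha : a ≠ 0 := by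
    rintro rfl
    simp [hi0] at hia
  set j := i * d - d * i with hj
  have hj0 : j ≠ 0 := fun h => hd (sub_eq_zero.mp h).symm
  have hji : j * i = -(i * j) := by
    have hc : i * i * d = d * (i * i) := by rw [hia, Algebra.commutes]
    rw [hj, sub_mul, mul_sub, ← mul_assoc i i d, hc]
    noncomm_ring
  have aux : ∀ r s : F, r • (1 : D) + s • i = 0 → r = 0 ∧ s = 0 := by
    intro r s h
    have hs : s = 0 := by
      by_contra hs
      apply hi
      have : i = algebraMap F D (-(r / s)) := by
        rw [Algebra.algebraMap_eq_smul_one]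
        have h' := congrArg (s⁻¹ • ·) h
        simp only [smul_add, smul_smul, inv_mul_cancel₀ hs, smul_zero] at h'
        linear_combination (norm := module) h'
      exact this ▸ Subalgebra.algebraMap_mem _ _
    subst hs
    simpa using h
  have hk : i * (i * j) * i = -(a • (i * j)) := by
    rw [← mul_assoc i i j, hia, mul_assoc, hji, Algebra.smul_def, mul_neg]
  have hiji : i * j * i = -(a • j) := by
    rw [mul_assoc, hji, mul_neg, ← mul_assoc, hia, Algebra.smul_def]
  have hii : i * i = a • (1 : D) := by rw [hia, Algebra.algebraMap_eq_smul_one]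
  have hli : LinearIndependent F ![1, i, j, i * j] := by
    rw [Fintype.linearIndependent_iff]
    intro g hg
    simp only [Fin.sum_univ_four, Matrix.cons_val] at hg
    have hconj : (a * g 0) • (1 : D) + (a * g 1) • i - (a * g 2) • j - (a * g 3) • (i * j) = 0 := by
      have := congrArg (i * · * i) hg
      simp only [mul_add, add_mul, mul_smul_comm, smul_mul_assoc, mul_one, hk, hiji, hii,
        one_mul, mul_zero, zero_mul] at this
      linear_combination (norm := module) this
    have h1 := aux (2 * a * g 0) (2 * a * g 1) (by
      linear_combination (norm := module) a • hg + hconj)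
    have h3 := aux (2 * a * g 2) (2 * a * g 3) (by
      apply mul_right_cancel₀ hj0
      rw [add_mul, smul_mul_assoc, smul_mul_assoc, one_mul, zero_mul]
      linear_combination (norm := module) a • hg - hconj)
    have h2a : 2 * a ≠ 0 := mul_ne_zero (NeZero.ne 2) ha
    simp only [mul_eq_zero, h2a, false_or] at h1 h3
    intro n
    fin_cases n
    exacts [h1.1, h1.2, h3.1, h3.2]
  have hspan := hli.span_eq_top_of_card_eq_finrank (by simp [hdim])
  have hji2 : i * (j * j) = j * j * i := by
    rw [mul_assoc, hji, mul_neg, ← mul_assoc j i j, hji, neg_mul, neg_neg, mul_assoc]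
  have hjj : j * j ∈ Subalgebra.center F D := by
    rw [Subalgebra.mem_center_iff]
    have hle : Submodule.span F (Set.range ![1, i, j, i * j]) ≤
        Subalgebra.toSubmodule (Subalgebra.centralizer F {j * j}) := by
      rw [Submodule.span_le]
      rintro _ ⟨n, rfl⟩
      simp only [SetLike.mem_coe, Subalgebra.mem_toSubmodule, Subalgebra.mem_centralizer_iff,
        Set.mem_singleton_iff, forall_eq]
      fin_cases n
      · simp
      · exact hji2.symm
      · exact mul_assoc j j j
      · change j * j * (i * j) = i * j * (j * j)
        rw [← mul_assoc, ← hji2]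
        simp only [mul_assoc]
    intro y
    have hy := hle (hspan ▸ Submodule.mem_top : y ∈ _)
    exact ((Subalgebra.mem_centralizer_iff F).mp hy _ rfl).symm
  rw [hcentral, Algebra.mem_bot] at hjj
  obtain ⟨b, hb⟩ := hjj
  refine ⟨a, b, ha, ?_, ⟨⟨i, j, i * j, by simp [hii], ?_, rfl, by simp [hji]⟩⟩⟩
  · rintro rfl
    rw [map_zero] at hb
    exact hj0 (mul_self_eq_zero.mp hb.symm)
  · rw [← hb, Algebra.algebraMap_eq_smul_one]

end DivisionRing

/-- Rescale the generators of a quaternion basis. -/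
def QuaternionAlgebra.Basis.rescale {K A : Type*} [Field K] [Ring A] [Algebra K A] {a b a' b' : K}
    (q : QuaternionAlgebra.Basis A a 0 b) (c d : K) (ha : c ^ 2 * a = a') (hb : d ^ 2 * b = b') :
    QuaternionAlgebra.Basis A a' 0 b' where
  i := c • q.i
  j := d • q.j
  k := (c * d) • q.k
  i_mul_i := by simp [← ha, smul_smul, sq, mul_assoc]
  j_mul_j := by simp [← hb, smul_smul, sq, mul_assoc]
  i_mul_j := by simp [smul_smul, mul_comm]
  j_mul_i := by simp [smul_smul, mul_comm]

/-- Extension of scalars of a quaternion basis. -/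
def QuaternionAlgebra.Basis.baseChange {F A : Type*} (K : Type*) [Field F] [Field K] [Algebra F K]
    [Ring A] [Algebra F A] {a b : F} {a' b' : K} (q : QuaternionAlgebra.Basis A a 0 b)
    (ha : algebraMap F K a = a') (hb : algebraMap F K b = b') :
    QuaternionAlgebra.Basis (K ⊗[F] A) a' 0 b' where
  i := 1 ⊗ₜ q.i
  j := 1 ⊗ₜ q.j
  k := 1 ⊗ₜ q.k
  i_mul_i := by simp [← ha, Algebra.TensorProduct.one_def]
  j_mul_j := by simp [← hb, Algebra.TensorProduct.one_def]
  i_mul_j := by simp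
  j_mul_i := by simp [TensorProduct.tmul_neg]

theorem Rat.exists_sq_mul_eq_squarefree {r : ℚ} (hr : r ≠ 0) :
    ∃ (c : ℚ) (m : ℤ), Squarefree m ∧ c ^ 2 * r = m := by
  obtain ⟨c, m, hc, h, hm⟩ := Int.exists_sq_mul_squarefree (n := r.num * r.den)
    (mul_ne_zero (Rat.num_ne_zero.mpr hr) (by exact_mod_cast r.den_ne_zero))
  refine ⟨r.den / c, m, hm, ?_⟩
  have hcq : (c : ℚ) ≠ 0 := by exact_mod_cast hc
  have hq : (r.num : ℚ) * r.den = c ^ 2 * m := by exact_mod_cast h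
  have hr' : r * r.den = r.num := Rat.mul_den_eq_num r
  field_simp
  linear_combination r.den * hr' + hq

/-- Let `D` be a quaternion division algebra over `ℚ` (a 4-dimensional central
division algebra).  If `D` splits at every odd prime `p` (i.e. `D ⊗_ℚ ℚ_p` is not a
division algebra), then `D ⊗_ℚ ℝ` is a division algebra; equivalently
`D ⊗_ℚ ℝ ≅ ℍ`, the Hamilton quaternions. -/
theorem stmt_17 {D : Type*} [DivisionRing D] [Algebra ℚ D]
    (hdim : Module.finrank ℚ D = 4) (hcentral : Subalgebra.center ℚ D = ⊥)
    (hsplit : ∀ (p : ℕ) [Fact p.Prime], p ≠ 2 → ∃ x : ℚ_[p] ⊗[ℚ] D, x ≠ 0 ∧ ¬ IsUnit x) :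
    (∀ x : ℝ ⊗[ℚ] D, x ≠ 0 → IsUnit x) ∧
    Nonempty ((ℝ ⊗[ℚ] D) ≃ₐ[ℝ] Quaternion ℝ) := by
  obtain ⟨a₀, b₀, ha₀, hb₀, ⟨q₀⟩⟩ := exists_quaternionBasis_of_finrank_eq_four hdim hcentral
  obtain ⟨c, a, ha, hca⟩ := Rat.exists_sq_mul_eq_squarefree ha₀
  obtain ⟨d, b, hb, hdb⟩ := Rat.exists_sq_mul_eq_squarefree hb₀
  let q := q₀.rescale c d hca hdb
  have hloc : ∀ (p : ℕ) [Fact p.Prime], p ≠ 2 → HasConicPoint ℚ_[p] (a : ℚ_[p]) (b : ℚ_[p]) := by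
    intro p _ hp
    obtain ⟨x, hx, hu⟩ := hsplit p hp
    let e := (q.baseChange ℚ_[p] (map_intCast _ a) (map_intCast _ b)).equivOfFinrank
      (Int.cast_ne_zero.mpr ha.ne_zero) (Int.cast_ne_zero.mpr hb.ne_zero)
      (by rw [Module.finrank_baseChange, hdim])
    exact QuaternionAlgebra.hasConicPoint_of_not_isUnit (e.symm x) (by simpa using hx)
      (by simpa using hu)
  have hnot : ¬ HasConicPoint ℚ (a : ℚ) (b : ℚ) := q.not_hasConicPoint
    (Int.cast_ne_zero.mpr ha.ne_zero) (Int.cast_ne_zero.mpr hb.ne_zero)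
  have hreal : ¬ HasConicPoint ℝ (a : ℝ) (b : ℝ) := fun h =>
    hnot (hasConicPoint_rat_of_squarefree a b ha hb h hloc)
  have ha_neg : (a : ℝ) < 0 := by
    by_contra! h
    exact hreal (.of_eq_sq (Real.sq_sqrt h).symm)
  have hb_neg : (b : ℝ) < 0 := by
    by_contra! h
    exact hreal (HasConicPoint.of_eq_sq (Real.sq_sqrt h).symm).symm
  have normalize : ∀ r : ℝ, r < 0 → (√(-r))⁻¹ ^ 2 * r = -1 := fun r hr => by
    rw [inv_pow, Real.sq_sqrt (by linarith), inv_neg, neg_mul, inv_mul_cancel₀ hr.ne]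
  let e : Quaternion ℝ ≃ₐ[ℝ] ℝ ⊗[ℚ] D :=
    ((q.baseChange ℝ (map_intCast _ a) (map_intCast _ b)).rescale _ _ (normalize a ha_neg)
      (normalize b hb_neg)).equivOfFinrank (by norm_num) (by norm_num)
      (by rw [Module.finrank_baseChange, hdim])
  refine ⟨fun x hx => ?_, ⟨e.symm⟩⟩
  have : IsUnit (e.symm x) := isUnit_iff_ne_zero.mpr (by simpa using hx)
  simpa using this
end

section
/- Let F be a subfield of ℂ and 𝔤 an F-split semisimple Lie algebra over F with split maximal torus 𝔱. For any dominant integral weight λ of 𝔱 (satisfying λ(𝔱_F) ⊆ F), the irreducible highest-weight representation V_F(λ) over F satisfies V_F(λ) ⊗_F ℂ ≅ V_ℂ(λ), the irreducible complex representation of 𝔤 ⊗_F ℂ with highest weight λ. Consequently every finite-dimensional complex representation of 𝔤 ⊗_F ℂ has an F-form. -/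
open TensorProduct

section Weyl

open LieAlgebra LieModule Module

variable {K L M : Type*} [Field K] [LieRing L] [LieAlgebra K L]

/-- A semisimple Lie algebra is perfect. -/
lemma LieAlgebra.IsSemisimple.derivedSeries_one_eq_top [FiniteDimensional K L] [IsSemisimple K L] :
    derivedSeries K L 1 = ⊤ := by
  set D := derivedSeries K L 1 with hD
  suffices Dᶜ = ⊥ by simpa using this
  refine (hasTrivialRadical_iff_no_abelian_ideals K L).mp inferInstance _ ?_
  rw [LieSubmodule.lie_abelian_iff_lie_self_eq_bot, eq_bot_iff, ← inf_compl_eq_bot (a := D)]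
  exact le_inf (LieSubmodule.mono_lie le_top le_top) (LieSubmodule.lie_le_right _ _)

/-- Every basis of a Killing Lie algebra has a dual family with respect to the Killing form. -/
lemma LieAlgebra.IsKilling.exists_dual_family [FiniteDimensional K L] [IsKilling K L]
    {ι : Type*} [Fintype ι] (b : Module.Basis ι K L) :
    ∃ b' : ι → L, (∀ y, b.repr y = fun j ↦ killingForm K L y (b' j)) ∧
      ∀ y, y = ∑ j, killingForm K L y (b j) • b' j := by
  classical
  set κ := killingForm K L
  have hκ : LinearMap.BilinForm.Nondegenerate κ := IsKilling.killingForm_nondegenerate K L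
  have hs : LinearMap.BilinForm.IsSymm κ := ⟨fun x y ↦ LieModule.traceForm_comm K L L x y⟩
  set b' := LinearMap.BilinForm.dualBasis κ hκ b with hb'
  refine ⟨b', fun y ↦ ?_, fun y ↦ ?_⟩
  · ext j
    rw [← LinearMap.BilinForm.dualBasis_repr_apply hκ, hb',
      LinearMap.BilinForm.dualBasis_dualBasis hκ hs b]
  · conv_lhs => rw [← b'.sum_repr y]
    refine Finset.sum_congr rfl fun j _ ↦ ?_
    rw [LinearMap.BilinForm.dualBasis_repr_apply]

/-- The tensor `∑ bᵢ ⊗ cᵢ` given by dual families for the Killing form is invariant. -/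
lemma LieAlgebra.sum_dual_family_invariant {ι X : Type*} [Fintype ι] [AddCommGroup X] [Module K X]
    {b b' : ι → L} (hb : ∀ y, y = ∑ j, killingForm K L y (b' j) • b j)
    (hb' : ∀ y, y = ∑ j, killingForm K L y (b j) • b' j) (B : L →ₗ[K] L →ₗ[K] X) (x : L) :
    ∑ i, B ⁅x, b i⁆ (b' i) = - ∑ i, B (b i) ⁅x, b' i⁆ := by
  set κ := killingForm K L
  have h1 : ∀ i, B ⁅x, b i⁆ (b' i) = ∑ j, κ ⁅x, b i⁆ (b' j) • B (b j) (b' i) := by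
    intro i
    conv_lhs => rw [hb ⁅x, b i⁆]
    simp
  have h2 : ∀ i, B (b i) ⁅x, b' i⁆ = ∑ j, κ ⁅x, b' i⁆ (b j) • B (b i) (b' j) := by
    intro i
    conv_lhs => rw [hb' ⁅x, b' i⁆]
    simp
  rw [eq_neg_iff_add_eq_zero]
  simp_rw [h1, h2]
  rw [Finset.sum_comm, ← Finset.sum_add_distrib]
  refine Finset.sum_eq_zero fun j _ ↦ ?_
  rw [← Finset.sum_add_distrib]
  refine Finset.sum_eq_zero fun i _ ↦ ?_
  rw [← add_smul, LieModule.traceForm_comm K L L ⁅x, b' j⁆, ← lie_skew, map_neg,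
    LinearMap.neg_apply,
    LieModule.traceForm_apply_lie_apply, neg_add_cancel, zero_smul]

/-- An endomorphism `T` of a finite-dimensional space in characteristic zero which is not nilpotent
has some polynomial `p` such that `T * p(T)` has non-zero trace. -/
lemma LinearMap.exists_trace_mul_aeval_ne_zero [CharZero K] {V : Type*}
    [AddCommGroup V] [Module K V]
    [FiniteDimensional K V] {T : Module.End K V} (hT : ¬ IsNilpotent T) :
    ∃ p : Polynomial K, LinearMap.trace K V (T * Polynomial.aeval T p) ≠ 0 := by
  obtain ⟨q, hq, hq0⟩ := Polynomial.exists_eq_pow_rootMultiplicity_mul_and_not_dvd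
    (minpoly K T) (minpoly.ne_zero (Algebra.IsIntegral.isIntegral T)) 0
  set a := (minpoly K T).rootMultiplicity 0
  rw [Polynomial.C_0, sub_zero] at hq hq0
  obtain ⟨u, v, huv⟩ : IsCoprime (Polynomial.X ^ (a + 1)) q :=
    (((Polynomial.irreducible_X).coprime_iff_not_dvd).mpr hq0).pow_left
  refine ⟨u * Polynomial.X ^ a, fun h ↦ hT ?_⟩
  have h0 : T ^ a * Polynomial.aeval T q = 0 := by
    simpa using (congrArg (Polynomial.aeval T) hq).symm.trans (minpoly.aeval K T)
  set E := Polynomial.aeval T (u * Polynomial.X ^ (a + 1)) with hE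
  set G := Polynomial.aeval T (v * q) with hG
  have hEG : E + G = 1 := by rw [hE, hG, ← map_add, huv, map_one]
  have hTG : T ^ a * G = 0 := by
    rw [hG, mul_comm v q, map_mul, ← mul_assoc, h0, zero_mul]
  have hEG0 : E * G = 0 := by
    rw [hE, pow_succ', ← mul_assoc, map_mul, map_pow, Polynomial.aeval_X, mul_assoc, hTG, mul_zero]
  have hEE : IsIdempotentElem E := by
    have := congrArg (E * ·) hEG
    simpa [mul_add, hEG0, IsIdempotentElem] using this
  have hE0 : E = 0 := by
    refine LinearMap.IsIdempotentElem.eq_zero_of_trace_eq_zero hEE ?_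
    have : T * Polynomial.aeval T (u * Polynomial.X ^ a) = E := by
      rw [hE, pow_succ', mul_left_comm, map_mul (Polynomial.aeval T) Polynomial.X,
        Polynomial.aeval_X]
    rw [← h, this]
  refine ⟨a, ?_⟩
  rw [← mul_one (T ^ a), ← hEG, hE0, zero_add, hTG]

/-- A nilpotent element of the centroid of a semisimple Lie algebra vanishes. -/
lemma LieAlgebra.IsSemisimple.eq_zero_of_isNilpotent_of_commute_ad [FiniteDimensional K L]
    [IsSemisimple K L]
    {T : Module.End K L} (hT : ∀ x, Commute T (ad K L x)) (hn : IsNilpotent T) : T = 0 := by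
  let C := Subalgebra.centralizer K (Set.range (ad K L))
  have hC : IsReduced C := by
    refine (isReduced_iff_pow_one_lt 2 one_lt_two).mpr fun ⟨S, hS⟩ h2 ↦ ?_
    have hS' (x y : L) : S ⁅x, y⁆ = ⁅x, S y⁆ :=
      (LinearMap.congr_fun (Subalgebra.mem_centralizer_iff K |>.mp hS _ ⟨x, rfl⟩) y).symm
    have h2' (x : L) : S (S x) = 0 := by
      have := congrArg (fun c : C ↦ (c : Module.End K L) x) h2
      simpa [pow_two] using this
    let S₁ : L →ₗ⁅K, L⁆ L := { S with map_lie' := hS' _ _ }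
    have : S₁.range = ⊥ := by
      refine (hasTrivialRadical_iff_no_abelian_ideals K L).mp inferInstance S₁.range ⟨?_⟩
      rintro ⟨-, x, rfl⟩ ⟨-, y, rfl⟩
      ext
      change ⁅S x, S y⁆ = 0
      rw [← hS', ← lie_skew, map_neg, hS', h2', lie_zero, neg_zero]
    ext x
    have hx : S₁ x ∈ S₁.range := ⟨x, rfl⟩
    rwa [this, LieSubmodule.mem_bot] at hx
  have hTC : T ∈ C := (Subalgebra.mem_centralizer_iff K).mpr <| by
    rintro - ⟨x, rfl⟩
    exact (hT x).eq.symm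
  obtain ⟨n, hn⟩ := hn
  have : IsNilpotent (⟨T, hTC⟩ : C) := ⟨n, Subtype.ext hn⟩
  exact congrArg Subtype.val this.eq_zero

/-- For a representation with non-zero trace form there is a modified Casimir operator with
non-zero trace. -/
lemma LieAlgebra.IsKilling.exists_sum_traceForm_ne_zero [CharZero K] [FiniteDimensional K L]
    [IsKilling K L]
    [AddCommGroup M] [Module K M] [LieRingModule L M] [LieModule K L M] [FiniteDimensional K M]
    (h0 : traceForm K L M ≠ 0) {ι : Type*} [Fintype ι] (b : Module.Basis ι K L) {b' : ι → L}
    (hb : ∀ y, b.repr y = fun j ↦ killingForm K L y (b' j)) :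
    ∃ φ : Module.End K L, (∀ x, Commute φ (ad K L x)) ∧
      ∑ i, traceForm K L M (φ (b i)) (b' i) ≠ 0 := by
  classical
  have hκ : LinearMap.BilinForm.Nondegenerate (killingForm K L) :=
    IsKilling.killingForm_nondegenerate K L
  let T : Module.End K L := (LinearMap.BilinForm.toDual (killingForm K L) hκ).symm ∘ₗ
    traceForm K L M
  have hT (x y : L) : killingForm K L (T x) y = traceForm K L M x y :=
    LinearMap.BilinForm.apply_toDual_symm_apply (hB := hκ) ..
  have hTad (x : L) : Commute T (ad K L x) := by
    ext y
    refine sub_eq_zero.mp (hκ.1 _ fun z ↦ ?_)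
    change killingForm K L (T ⁅x, y⁆ - ⁅x, T y⁆) z = 0
    rw [map_sub, LinearMap.sub_apply, hT, ← lie_skew x y, ← lie_skew x (T y), map_neg, map_neg,
      LinearMap.neg_apply, LinearMap.neg_apply, LieModule.traceForm_apply_lie_apply,
      LieModule.traceForm_apply_lie_apply K L L, ← hT, sub_self]
  have hT0 : T ≠ 0 := fun h ↦ h0 <| by
    ext x y
    simp [← hT, h]
  obtain ⟨p, hp⟩ := LinearMap.exists_trace_mul_aeval_ne_zero
    fun hn ↦ hT0 (IsSemisimple.eq_zero_of_isNilpotent_of_commute_ad hTad hn)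
  refine ⟨Polynomial.aeval T p, fun x ↦ ?_, fun h ↦ hp ?_⟩
  · exact ((Algebra.commute_of_mem_adjoin_singleton_of_commute
      (Polynomial.aeval_mem_adjoin_singleton K T) (hTad x).symm)).symm
  · rw [LinearMap.trace_eq_matrix_trace K b, ← h]
    simp [Matrix.trace, LinearMap.toMatrix_apply, hb, hT]

variable [AddCommGroup M] [Module K M] [LieRingModule L M] [LieModule K L M]

lemma LieAlgebra.IsKilling.exists_eq_lie_of_traceForm_ne_zero [CharZero K]
    [FiniteDimensional K L] [IsKilling K L] [FiniteDimensional K M]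
    (hirr : ∀ N : LieSubmodule K L M, N = ⊥ ∨ N = ⊤) (h0 : traceForm K L M ≠ 0)
    (f : L →ₗ[K] M) (hf : ∀ x y, f ⁅x, y⁆ = ⁅x, f y⁆ - ⁅y, f x⁆) :
    ∃ m, ∀ x, f x = ⁅x, m⁆ := by
  let b := Module.finBasis K L
  obtain ⟨b', hb, hb'⟩ := exists_dual_family b
  have hb₁ (y : L) : y = ∑ j, killingForm K L y (b' j) • b j := by
    conv_lhs => rw [← b.sum_repr y, hb]
  obtain ⟨φ, hφ, hφ0⟩ := exists_sum_traceForm_ne_zero h0 b hb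
  have hφ' (x y : L) : φ ⁅x, y⁆ = ⁅x, φ y⁆ := LinearMap.congr_fun (hφ x).eq y
  let c : Module.End K M := ∑ i, toEnd K L M (φ (b i)) * toEnd K L M (b' i)
  have hc (x : L) (m : M) : ⁅x, c m⁆ = c ⁅x, m⁆ := by
    have := sum_dual_family_invariant hb₁ hb' (LinearMap.mk₂ K
      (fun u v : L ↦ ⁅φ u, ⁅v, m⁆⁆) (by simp) (by simp) (by simp) (by simp)) x
    simp only [LinearMap.mk₂_apply, hφ'] at this
    simp only [c, LinearMap.sum_apply, Module.End.mul_apply, toEnd_apply_apply, lie_sum]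
    rw [← sub_eq_zero, ← Finset.sum_sub_distrib, ← add_eq_zero_iff_eq_neg.mpr this,
      ← Finset.sum_add_distrib]
    refine Finset.sum_congr rfl fun i _ ↦ ?_
    rw [leibniz_lie x, leibniz_lie x (b' i), lie_add]
    abel
  have hc0 : c ≠ 0 := fun h ↦ hφ0 <| by
    rw [← map_zero (LinearMap.trace K M), ← h, map_sum]
    rfl
  let c₁ : M →ₗ⁅K, L⁆ M := { c with map_lie' := (hc _ _).symm }
  have hker : c₁.ker = ⊥ := by
    refine (hirr c₁.ker).resolve_right fun h ↦ hc0 ?_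
    ext m
    exact c₁.mem_ker.mp (h ▸ LieSubmodule.mem_top m)
  have hinj : Function.Injective c := (LieModuleHom.ker_eq_bot c₁).mp hker
  have hsurj : Function.Surjective c := LinearMap.injective_iff_surjective.mp hinj
  obtain ⟨m, hm⟩ := hsurj (∑ i, ⁅φ (b i), f (b' i)⁆)
  refine ⟨m, fun x ↦ hinj ?_⟩
  rw [← hc, hm, eq_comm]
  have := sum_dual_family_invariant hb₁ hb' (LinearMap.mk₂ K
      (fun u v : L ↦ ⁅φ u, f v⁆) (by simp) (by simp) (by simp) (by simp)) x
  simp only [LinearMap.mk₂_apply, hφ'] at this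
  simp only [c, LinearMap.sum_apply, Module.End.mul_apply, toEnd_apply_apply, lie_sum]
  rw [← sub_eq_zero, ← Finset.sum_sub_distrib, ← add_eq_zero_iff_eq_neg.mpr this,
    ← Finset.sum_add_distrib]
  refine Finset.sum_congr rfl fun i _ ↦ ?_
  rw [leibniz_lie x, hf, lie_sub]
  abel

lemma LieAlgebra.IsKilling.exists_eq_lie_of_traceForm_eq_zero [CharZero K]
    [FiniteDimensional K L] [IsKilling K L] [FiniteDimensional K M]
    (hirr : ∀ N : LieSubmodule K L M, N = ⊥ ∨ N = ⊤) (h0 : traceForm K L M = 0)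
    (f : L →ₗ[K] M) (hf : ∀ x y, f ⁅x, y⁆ = ⁅x, f y⁆ - ⁅y, f x⁆) :
    ∃ m, ∀ x, f x = ⁅x, m⁆ := by
  cases subsingleton_or_nontrivial M
  · exact ⟨0, fun x ↦ Subsingleton.elim _ _⟩
  have hD := IsSemisimple.derivedSeries_one_eq_top (K := K) (L := L)
  have hnil := isNilpotent_derivedSeries_of_traceForm_eq_zero h0
  have : IsNilpotent L M := by
    rw [isNilpotent_iff_forall' (R := K)] at hnil ⊢
    exact fun x ↦ hnil ⟨x, hD ▸ LieSubmodule.mem_top x⟩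
  have htriv : maxTrivSubmodule K L M = ⊤ :=
    (hirr _).resolve_left ((LieSubmodule.nontrivial_iff_ne_bot ..).mp
      (nontrivial_max_triv_of_isNilpotent K L M))
  have htriv' (x : L) (m : M) : ⁅x, m⁆ = 0 :=
    (mem_maxTrivSubmodule K L M m).mp (htriv ▸ LieSubmodule.mem_top m) x
  refine ⟨0, fun x ↦ ?_⟩
  have hx : x ∈ Submodule.span K {⁅x, y⁆ | (x : L) (y : L)} := by
    rw [← coe_derivedSeries_one_eq, hD]
    trivial
  rw [lie_zero]
  induction hx using Submodule.span_induction with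
  | mem x hx =>
    obtain ⟨y, z, rfl⟩ := hx
    rw [hf, htriv', htriv', sub_zero]
  | zero => simp
  | add x y _ _ hx hy => rw [map_add, hx, hy, add_zero]
  | smul a x _ hx => rw [map_smul, hx, smul_zero]

/-- **Whitehead's first lemma**. -/
theorem LieAlgebra.IsKilling.exists_eq_lie_of_cocycle [CharZero K]
    [FiniteDimensional K L] [IsKilling K L] [FiniteDimensional K M]
    (f : L →ₗ[K] M) (hf : ∀ x y, f ⁅x, y⁆ = ⁅x, f y⁆ - ⁅y, f x⁆) :
    ∃ m, ∀ x, f x = ⁅x, m⁆ := by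
  induction hn : finrank K M using Nat.strong_induction_on generalizing M with
  | _ n ih
  by_cases hirr : ∀ N : LieSubmodule K L M, N = ⊥ ∨ N = ⊤
  · by_cases h0 : traceForm K L M = 0
    · exact exists_eq_lie_of_traceForm_eq_zero hirr h0 f hf
    · exact exists_eq_lie_of_traceForm_ne_zero hirr h0 f hf
  push Not at hirr
  obtain ⟨N, hbot, htop⟩ := hirr
  have hN : finrank K N < n := hn ▸ Submodule.finrank_lt (s := N.toSubmodule) (by simpa using htop)
  have hQ : finrank K (M ⧸ N) < n := by
    have h1 := Submodule.finrank_quotient_add_finrank N.toSubmodule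
    have h2 : finrank K N.toSubmodule ≠ 0 := by
      rw [Ne, Submodule.finrank_eq_zero]
      simpa using hbot
    change finrank K (M ⧸ N.toSubmodule) < n
    omega
  obtain ⟨m', hm'⟩ := ih _ hQ ((LieSubmodule.Quotient.mk' N : M →ₗ[K] M ⧸ N) ∘ₗ f)
    (fun x y ↦ by
      change LieSubmodule.Quotient.mk' N (f ⁅x, y⁆) = ⁅x, LieSubmodule.Quotient.mk' N (f y)⁆ -
        ⁅y, LieSubmodule.Quotient.mk' N (f x)⁆
      rw [hf, map_sub, LieModuleHom.map_lie, LieModuleHom.map_lie]) rfl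
  obtain ⟨m, rfl⟩ := LieSubmodule.Quotient.surjective_mk' N m'
  have hmem (x : L) : f x - ⁅x, m⁆ ∈ N := by
    rw [← LieSubmodule.Quotient.mk_eq_zero']
    change LieSubmodule.Quotient.mk' N (f x - ⁅x, m⁆) = 0
    rw [map_sub, LieModuleHom.map_lie, ← hm' x]
    exact sub_self _
  let g : L →ₗ[K] N :=
    { toFun x := ⟨f x - ⁅x, m⁆, hmem x⟩
      map_add' x y := by ext; simp; abel
      map_smul' a x := by ext; simp [smul_sub] }
  obtain ⟨k, hk⟩ := ih _ hN g (fun x y ↦ by ext; simp [g, hf]; abel) rfl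
  refine ⟨m + k, fun x ↦ ?_⟩
  have := congrArg Subtype.val (hk x)
  rw [lie_add, ← LieSubmodule.coe_bracket, ← this]
  simp [g]

/-- **Weyl's complete reducibility theorem**. -/
theorem LieAlgebra.IsKilling.complementedLattice_lieSubmodule [CharZero K]
    [FiniteDimensional K L] [IsKilling K L] [FiniteDimensional K M] :
    ComplementedLattice (LieSubmodule K L M) := by
  refine ⟨fun N ↦ ?_⟩
  obtain ⟨π₀, hπ₀⟩ : ∃ π₀ : M →ₗ[K] N, ∀ n : N, π₀ n = n := by
    obtain ⟨g, hg⟩ := N.toSubmodule.subtype.exists_leftInverse_of_injective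
      N.toSubmodule.ker_subtype
    exact ⟨g, fun n ↦ LinearMap.congr_fun hg n⟩
  let Z : LieSubmodule K L (M →ₗ[K] N) :=
    { carrier := {g | ∀ n : N, g n = 0}
      add_mem' := fun {g₁ g₂} h₁ h₂ n ↦ by simp [h₁ n, h₂ n]
      zero_mem' := fun n ↦ rfl
      smul_mem' := fun a g h n ↦ by simp [h n]
      lie_mem := fun {x g} h n ↦ by
        have := h ⁅x, n⁆
        simp_all [LieHom.lie_apply] }
  have hZ (x : L) : ⁅x, π₀⁆ ∈ Z := fun n ↦ by
    have := hπ₀ ⁅x, n⁆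
    simp_all [LieHom.lie_apply]
  let f : L →ₗ[K] Z :=
    { toFun x := ⟨⁅x, π₀⁆, hZ x⟩
      map_add' x y := by ext1; simp
      map_smul' a x := by ext1; simp }
  obtain ⟨z, hz⟩ := exists_eq_lie_of_cocycle f (fun x y ↦ by ext1; simp [f, lie_lie])
  let π : M →ₗ[K] N := π₀ - z.1
  have hπN (n : N) : π n = n := by
    have := z.2 n
    rw [LinearMap.sub_apply, hπ₀, this, sub_zero]
  have hπ (x : L) (m : M) : π ⁅x, m⁆ = ⁅x, π m⁆ := by
    have := LinearMap.congr_fun (congrArg Subtype.val (hz x)) m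
    change ⁅x, π₀ m⁆ - π₀ ⁅x, m⁆ = ⁅x, z.1 m⁆ - z.1 ⁅x, m⁆ at this
    change π₀ ⁅x, m⁆ - z.1 ⁅x, m⁆ = ⁅x, π₀ m - z.1 m⁆
    rw [sub_eq_sub_iff_add_eq_add] at this
    rw [lie_sub, sub_eq_sub_iff_add_eq_add, eq_comm, add_comm (π₀ _), this, add_comm]
  let π₁ : M →ₗ⁅K, L⁆ N := { π with map_lie' := hπ _ _ }
  refine ⟨π₁.ker, ?_, ?_⟩
  · rw [disjoint_iff, eq_bot_iff]
    rintro m ⟨hmN, hm⟩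
    have h1 : π m = 0 := π₁.mem_ker.mp hm
    rw [hπN ⟨m, hmN⟩] at h1
    simpa using congrArg Subtype.val h1
  · rw [codisjoint_iff, eq_top_iff]
    intro m _
    rw [← add_sub_cancel (π m : M) m]
    refine add_mem (le_sup_left (a := N) (π m).2) (le_sup_right (a := N) (π₁.mem_ker.mpr ?_))
    change π (m - π m) = 0
    rw [map_sub, hπN, sub_self]

end Weyl

section Grading

open LieAlgebra LieAlgebra.IsKilling LieModule Module

variable {F L : Type*} [Field F] [CharZero F] [LieRing L] [LieAlgebra F L]
  [FiniteDimensional F L] [IsKilling F L] (H : LieSubalgebra F L) [H.IsCartanSubalgebra]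
  [IsTriangularizable F H L]

/-- In a split Cartan subalgebra there is an element on which every root takes a non-zero rational
value. -/
lemma LieAlgebra.IsKilling.exists_forall_root_eq_ratCast :
    ∃ h : H, ∀ α : Weight F H L, α.IsNonZero → ∃ q : ℚ, q ≠ 0 ∧ α h = q := by
  classical
  let A (α β : H.root) : ℤ := chainBotCoeff β.1 α.1 - chainTopCoeff β.1 α.1
  have hA (α β : H.root) : α.1 (coroot β.1) = A α β := apply_coroot_eq_cast β.1 α.1
  have hA2 (α : H.root) : A α α = 2 := by
    have := hA α α
    rw [root_apply_coroot ((Finset.mem_filter.mp α.2).2)] at this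
    exact_mod_cast this.symm
  obtain ⟨c, hc⟩ := Module.Dual.exists_forall_ne_zero_of_forall_exists
    (fun α : H.root ↦ Fintype.linearCombination ℚ (fun β ↦ (A α β : ℚ)))
    (fun α ↦ ⟨Pi.single α 1, by simp [Fintype.linearCombination_apply_single, hA2]⟩)
  refine ⟨∑ β : H.root, (c β : F) • coroot β.1, fun α hα ↦ ?_⟩
  refine ⟨_, hc ⟨α, by simpa using hα⟩, ?_⟩
  rw [← Weight.toLinear_apply, map_sum, Fintype.linearCombination_apply, Rat.cast_sum]
  refine Finset.sum_congr rfl fun β _ ↦ ?_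
  have := hA ⟨α, by simpa using hα⟩ β
  simp_all

/-- A split semisimple Lie algebra has an element acting diagonally with rational eigenvalues,
whose centralizer is abelian and spanned by the semisimple parts of `sl₂`-triples with raising
operator of positive degree. -/
lemma LieAlgebra.IsKilling.exists_rational_grading :
    ∃ h ∈ H, (∀ x ∈ H, ∀ y ∈ H, ⁅x, y⁆ = 0) ∧
      Submodule.span F ({x | x ∈ H} ∪ {x | ∃ q : ℚ, q ≠ 0 ∧ ⁅h, x⁆ = (q : F) • x}) = ⊤ ∧
      ∀ x ∈ H, x ∈ Submodule.span F {t : L | t ∈ H ∧ ∃ (e f : L) (q : ℚ),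
        0 < q ∧ IsSl2Triple t e f ∧ ⁅h, e⁆ = (q : F) • e} := by
  obtain ⟨h, hh⟩ := exists_forall_root_eq_ratCast H
  refine ⟨h, h.2, fun x hx y hy ↦ ?_, ?_, fun x hx ↦ ?_⟩
  · exact congrArg Subtype.val (trivial_lie_zero H H ⟨x, hx⟩ ⟨y, hy⟩)
  · have := cartan_sup_iSup_rootSpace_eq_top (K := F) (L := L) (H := H)
    rw [← LieSubmodule.toSubmodule_inj, LieSubmodule.top_toSubmodule] at this
    rw [eq_top_iff, ← this, LieSubmodule.sup_toSubmodule, sup_le_iff]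
    refine ⟨fun x hx ↦ Submodule.subset_span (Or.inl hx), ?_⟩
    simp only [LieSubmodule.iSup_toSubmodule, iSup_le_iff]
    intro α hα x hx
    obtain ⟨q, hq0, hq⟩ := hh α hα
    exact Submodule.subset_span (Or.inr ⟨q, hq0, hq ▸ lie_eq_smul_of_mem_rootSpace hx h⟩)
  · have hpos (α : Weight F H L) (hα : α.IsNonZero) (q : ℚ) (hq0 : 0 < q) (hq : α h = q) :
        ((coroot α : H) : L) ∈ {t : L | t ∈ H ∧ ∃ (e f : L) (q : ℚ),
          0 < q ∧ IsSl2Triple t e f ∧ ⁅(h : L), e⁆ = (q : F) • e} := by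
      obtain ⟨t, e, f, ht, he, hf⟩ := exists_isSl2Triple_of_weight_isNonZero hα
      obtain rfl := ht.h_eq_coroot hα he hf
      exact ⟨(coroot α).2, e, f, q, hq0, ht, hq ▸ lie_eq_smul_of_mem_rootSpace he h⟩
    have hspan := congrArg (Submodule.map H.toSubmodule.subtype)
      (RootPairing.IsRootSystem.span_coroot_eq_top (P := rootSystem H))
    rw [Submodule.map_span] at hspan
    have hx' : x ∈ Submodule.map H.toSubmodule.subtype ⊤ := ⟨⟨x, hx⟩, trivial, rfl⟩
    rw [← hspan] at hx'
    refine Submodule.span_le.mpr ?_ hx'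
    rintro - ⟨-, ⟨⟨α, hα⟩, rfl⟩, rfl⟩
    replace hα : α.IsNonZero := by simpa using hα
    obtain ⟨q, hq0, hq⟩ := hh α hα
    rcases hq0.lt_or_gt with hneg | hq0
    · rw [SetLike.mem_coe, ← Submodule.neg_mem_iff]
      have := hpos (-α) hα.neg (-q) (by simpa using hneg) (by simp [hq])
      refine Submodule.subset_span ?_
      simpa using this
    · exact Submodule.subset_span (hpos α hα q hq0 hq)

end Grading

section Descent

open LieAlgebra Module

variable {F K L M : Type*} [Field F] [Field K] [Algebra F K] [AddCommGroup M]
  [Module K M]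

/-- For a representation of `sl₂`, the weight of a vector killed by `e` is a natural number. -/
lemma IsSl2Triple.exists_nat_of_map [CharZero K] [FiniteDimensional K M] [LieRing L] {t e f : L}
    (h : IsSl2Triple t e f)
    (ρ : L →+ Module.End K M) (hρ : ∀ x y, ρ ⁅x, y⁆ = ρ x * ρ y - ρ y * ρ x)
    {w : M} (hw : w ≠ 0) {a : K} (ht : ρ t w = a • w) (he : ρ e w = 0) : ∃ n : ℕ, a = n := by
  let : LieRing (Module.End K M) := LieRing.ofAssociativeRing
  by_cases h0 : ρ t = 0
  · refine ⟨0, ?_⟩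
    rw [h0, LinearMap.zero_apply, eq_comm, smul_eq_zero] at ht
    simpa using ht.resolve_right hw
  have hbr (x y : L) : ρ ⁅x, y⁆ = ⁅ρ x, ρ y⁆ := hρ x y
  have h' : IsSl2Triple (ρ t) (ρ e) (ρ f) :=
    { h_ne_zero := h0
      lie_e_f := by rw [← hbr, h.lie_e_f]
      lie_h_e_nsmul := by rw [← hbr, h.lie_h_e_nsmul, map_nsmul]
      lie_h_f_nsmul := by rw [← hbr, h.lie_h_f_nsmul, map_neg, map_nsmul] }
  have hv : h'.HasPrimitiveVectorWith w a := ⟨hw, ht, he⟩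
  exact hv.exists_nat

/-- A commuting family of endomorphisms over an algebraically closed field has a common eigenvector
in every non-zero stable subspace. -/
lemma Module.End.exists_common_eigenvector [IsAlgClosed K] [FiniteDimensional K M]
    {S : Set (Module.End K M)} (hS : ∀ f ∈ S, ∀ g ∈ S, Commute f g) {E : Submodule K M}
    (hE : E ≠ ⊥) (hstab : ∀ f ∈ S, ∀ m ∈ E, f m ∈ E) :
    ∃ w ∈ E, w ≠ 0 ∧ ∀ f ∈ S, ∃ a : K, f w = a • w := by
  obtain ⟨P, ⟨hPE, hP0, hP⟩, hmin⟩ := exists_minimal_of_wellFoundedLT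
    (fun P : Submodule K M ↦ P ≤ E ∧ P ≠ ⊥ ∧ ∀ f ∈ S, ∀ m ∈ P, f m ∈ P) ⟨E, le_rfl, hE, hstab⟩
  obtain ⟨w, hwP, hw0⟩ := P.exists_mem_ne_zero_of_ne_bot hP0
  refine ⟨w, hPE hwP, hw0, fun f hf ↦ ?_⟩
  have : Nontrivial P := P.nontrivial_iff_ne_bot.mpr hP0
  obtain ⟨a, ha⟩ := Module.End.exists_eigenvalue (f.restrict (hP f hf))
  obtain ⟨v, hv⟩ := ha.exists_hasEigenvector
  have hle := hmin (y := P ⊓ f.eigenspace a) ⟨inf_le_left.trans hPE, ?_, ?_⟩ inf_le_left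
  · exact ⟨a, Module.End.mem_eigenspace_iff.mp (hle hwP).2⟩
  · refine (Submodule.ne_bot_iff _).mpr ⟨v, ⟨v.2, ?_⟩, by simpa using hv.2⟩
    exact Module.End.mem_eigenspace_iff.mpr (congrArg Subtype.val hv.apply_eq_smul)
  · rintro g hg m ⟨hmP, hm⟩
    refine ⟨hP g hg m hmP, ?_⟩
    rw [SetLike.mem_coe, Module.End.mem_eigenspace_iff] at hm ⊢
    rw [← Module.End.mul_apply, (hS f hf g hg).eq, Module.End.mul_apply, hm, map_smul]

/-- An endomorphism has an eigenvalue which is maximal in its class modulo `ℚ`. -/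
lemma Module.End.exists_hasEigenvalue_forall_not_hasEigenvalue_add [CharZero K] [IsAlgClosed K]
    [FiniteDimensional K M] [Nontrivial M] (D : Module.End K M) :
    ∃ c : K, D.HasEigenvalue c ∧ ∀ q : ℚ, 0 < q → ¬ D.HasEigenvalue (c + q) := by
  obtain ⟨c₀, hc₀⟩ := D.exists_eigenvalue
  have hfin : {q : ℚ | D.HasEigenvalue (c₀ + q)}.Finite :=
    D.finite_hasEigenvalue.preimage (f := fun q : ℚ ↦ c₀ + (q : K))
      (fun a _ b _ h ↦ by simpa using h)
  obtain ⟨q₀, hq₀⟩ := hfin.exists_maximal ⟨0, by simpa using hc₀⟩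
  refine ⟨c₀ + q₀, hq₀.1, fun q hq h ↦ ?_⟩
  have := hq₀.2 (y := q₀ + q) (by simpa [add_assoc] using h) (by linarith)
  linarith

variable [Module F M] [IsScalarTower F K M]

/-- Let `B` be an `F`-subspace of an irreducible `K`-linear representation which is stable under
the action and on which some non-zero `K`-linear functional takes values in `F`. Then `F`-linearly
independent vectors of `B` are `K`-linearly independent. -/
lemma LinearIndependent.of_stable_of_functional {S : Set (Module.End K M)}
    (hirr : ∀ P : Submodule K M, (∀ g ∈ S, ∀ m ∈ P, g m ∈ P) → P = ⊥ ∨ P = ⊤)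
    {B : Submodule F M} (hB : ∀ g ∈ S, ∀ m ∈ B, g m ∈ B) {l : Module.Dual K M} (hl : l ≠ 0)
    (hlB : ∀ m ∈ B, l m ∈ Set.range (algebraMap F K)) {ι : Type*} {v : ι → M}
    (hvB : ∀ i, v i ∈ B) (hv : LinearIndependent F v) : LinearIndependent K v := by
  let Λ : Set (Module.Dual K M) := {φ | ∀ m ∈ B, φ m ∈ Set.range (algebraMap F K)}
  let R : Set M := {u | u ∈ B ∧ ∀ φ ∈ Λ, φ u = 0}
  have hR : Submodule.span K R = ⊥ := by
    refine (hirr _ fun g hg m hm ↦ ?_).resolve_right fun h ↦ hl ?_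
    · induction hm using Submodule.span_induction with
      | mem m hm =>
        exact Submodule.subset_span ⟨hB g hg m hm.1, fun φ hφ ↦
          hm.2 (φ ∘ₗ g) fun u hu ↦ hφ _ (hB g hg u hu)⟩
      | zero => simp
      | add x y _ _ hx hy => rw [map_add]; exact add_mem hx hy
      | smul a x _ hx => rw [map_smul]; exact Submodule.smul_mem _ a hx
    · have : Submodule.span K R ≤ LinearMap.ker l :=
        Submodule.span_le.mpr fun u hu ↦ hu.2 l hlB
      rw [h, top_le_iff, LinearMap.ker_eq_top] at this
      exact this
  rw [linearIndependent_iff'] at hv ⊢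
  intro s c hc i hi
  by_contra hci
  obtain ⟨θ, hθ⟩ : ∃ θ : Module.Dual F K, θ (c i) ≠ 0 := by
    by_contra! h
    exact hci ((Module.forall_dual_apply_eq_zero_iff F _).mp h)
  refine hθ (hv s (fun j ↦ θ (c j)) ?_ i hi)
  have hmem : ∑ j ∈ s, θ (c j) • v j ∈ R := by
    refine ⟨sum_mem fun j _ ↦ B.smul_mem _ (hvB j), fun φ hφ ↦ ?_⟩
    choose a ha using fun j ↦ hφ (v j) (hvB j)
    have h1 : ∑ j ∈ s, a j • c j = 0 := by
      simpa [← ha, Algebra.smul_def, mul_comm] using congrArg φ hc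
    have h2 := congrArg θ h1
    rw [map_sum, map_zero] at h2
    rw [map_sum, ← map_zero (algebraMap F K), ← h2, map_sum]
    refine Finset.sum_congr rfl fun j _ ↦ ?_
    rw [← algebraMap_smul K, map_smul, ← ha, map_smul θ, smul_eq_mul, smul_eq_mul, map_mul,
      mul_comm]
  have := Submodule.subset_span (R := K) hmem
  rwa [hR] at this

end Descent

section Form

open LieAlgebra Module

variable {F K L M : Type*} [Field F] [Field K] [Algebra F K] [AddCommGroup M]
  [Module K M] [LieRing L] [LieAlgebra F L] [Module F M] [IsScalarTower F K M]

/-- Elements of degree `q` shift the eigenvalues of a grading element by `q`. -/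
lemma Module.End.apply_mem_eigenspace_add {ρ : L →ₗ[F] Module.End K M}
    (hρ : ∀ x y, ρ ⁅x, y⁆ = ρ x * ρ y - ρ y * ρ x) {h x : L} {q : ℚ} (hx : ⁅h, x⁆ = (q : F) • x)
    {a : K} {m : M} (hm : m ∈ (ρ h).eigenspace a) : ρ x m ∈ (ρ h).eigenspace (a + (q : K)) := by
  have hq : ((q : F) • ρ x m) = (q : K) • ρ x m := by
    rw [← algebraMap_smul K (q : F)]
    congr 1
    exact map_ratCast (algebraMap F K) q
  rw [Module.End.mem_eigenspace_iff] at hm ⊢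
  have h1 := congrArg (fun g ↦ g m) (hρ h x)
  simp only [hx, map_smul, LinearMap.smul_apply, LinearMap.sub_apply, Module.End.mul_apply,
    hm, hq] at h1
  rw [add_smul, h1]
  abel

/-- A non-zero representation over an algebraically closed field has a highest weight vector, and
its weight takes values in the field over which the Lie algebra is split. -/
lemma LieAlgebra.exists_highest_weight_vector [CharZero K] [IsAlgClosed K] [FiniteDimensional K M]
    [Nontrivial M] {ρ : L →ₗ[F] Module.End K M} (hρ : ∀ x y, ρ ⁅x, y⁆ = ρ x * ρ y - ρ y * ρ x)
    {H : LieSubalgebra F L} {h : L} (hh : h ∈ H) (hH : ∀ x ∈ H, ∀ y ∈ H, ⁅x, y⁆ = 0)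
    (hspan : ∀ x ∈ H, x ∈ Submodule.span F {t : L | t ∈ H ∧ ∃ (e f : L) (q : ℚ), 0 < q ∧
      IsSl2Triple t e f ∧ ⁅h, e⁆ = (q : F) • e}) :
    ∃ (w : M) (c : K), w ≠ 0 ∧ ρ h w = c • w ∧
      (∀ (x : L) (q : ℚ), 0 < q → ⁅h, x⁆ = (q : F) • x → ρ x w = 0) ∧
      ∀ x ∈ H, ∃ a : F, ρ x w = a • w := by
  obtain ⟨c, hc, hmax⟩ := (ρ h).exists_hasEigenvalue_forall_not_hasEigenvalue_add
  have hcomm (x : L) (hx : x ∈ H) (y : L) (hy : y ∈ H) : Commute (ρ x) (ρ y) := by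
    have := hρ x y
    rwa [hH x hx y hy, map_zero, eq_comm, sub_eq_zero] at this
  obtain ⟨w, hwE, hw0, hw⟩ := Module.End.exists_common_eigenvector (S := ρ '' H)
    (E := (ρ h).eigenspace c)
    (by rintro _ ⟨x, hx, rfl⟩ _ ⟨y, hy, rfl⟩; exact hcomm x hx y hy) hc (by
      rintro _ ⟨x, hx, rfl⟩ m hm
      rw [Module.End.mem_eigenspace_iff] at hm ⊢
      rw [← Module.End.mul_apply, (hcomm h hh x hx).eq, Module.End.mul_apply, hm, map_smul])
  have hkill (x : L) (q : ℚ) (hq : 0 < q) (hx : ⁅h, x⁆ = (q : F) • x) : ρ x w = 0 := by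
    by_contra hne
    refine hmax q hq ((Submodule.ne_bot_iff _).mpr ⟨_, ?_, hne⟩)
    exact Module.End.apply_mem_eigenspace_add hρ hx hwE
  refine ⟨w, c, hw0, Module.End.mem_eigenspace_iff.mp hwE, hkill, fun x hx ↦ ?_⟩
  replace hx := hspan x hx
  induction hx using Submodule.span_induction with
  | mem t ht =>
    obtain ⟨htH, e, f, q, hq, htri, he⟩ := ht
    obtain ⟨a, ha⟩ := hw _ ⟨t, htH, rfl⟩
    obtain ⟨n, rfl⟩ := htri.exists_nat_of_map (ρ : L →+ Module.End K M) hρ hw0 ha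
      (hkill e q hq he)
    refine ⟨n, ha.trans ?_⟩
    rw [← algebraMap_smul K (n : F), map_natCast]
  | zero => exact ⟨0, by simp⟩
  | add x y _ _ hx hy =>
    obtain ⟨⟨a, ha⟩, b, hb⟩ := And.intro hx hy
    exact ⟨a + b, by rw [map_add, LinearMap.add_apply, ha, hb, add_smul]⟩
  | smul b x _ hx =>
    obtain ⟨a, ha⟩ := hx
    exact ⟨b * a, by rw [map_smul, LinearMap.smul_apply, ha, mul_smul]⟩

/-- The `F`-span of the vectors obtained from a highest weight vector by applying elements of
negative degree is stable, and its vectors have their top component in the `F`-line of the highest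
weight vector. -/
lemma LieAlgebra.exists_stable_le_span_singleton_sup [CharZero K]
    {ρ : L →ₗ[F] Module.End K M} (hρ : ∀ x y, ρ ⁅x, y⁆ = ρ x * ρ y - ρ y * ρ x)
    {H : LieSubalgebra F L} {h : L}
    (hspan : Submodule.span F ({x | x ∈ H} ∪ {x | ∃ q : ℚ, q ≠ 0 ∧ ⁅h, x⁆ = (q : F) • x}) = ⊤)
    {w : M} {c : K} (hwc : ρ h w = c • w)
    (hpos : ∀ (x : L) (q : ℚ), 0 < q → ⁅h, x⁆ = (q : F) • x → ρ x w = 0)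
    (hwH : ∀ x ∈ H, ∃ a : F, ρ x w = a • w) :
    ∃ B : Submodule F M, w ∈ B ∧ (∀ x, ∀ m ∈ B, ρ x m ∈ B) ∧
      B ≤ Submodule.span F {w} ⊔
        (⨆ a ∈ {a : K | a ≠ c}, (ρ h).eigenspace a).restrictScalars F := by
  let N : Set L := {y | ∃ q : ℚ, q < 0 ∧ ⁅h, y⁆ = (q : F) • y}
  let 𝓑 : Set (Submodule F M) := {P | w ∈ P ∧ ∀ y ∈ N, ∀ m ∈ P, ρ y m ∈ P}
  let B : Submodule F M := sInf 𝓑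
  have hwB : w ∈ B := Submodule.mem_sInf.mpr fun P hP ↦ hP.1
  have hNB (y : L) (hy : y ∈ N) (m : M) (hm : m ∈ B) : ρ y m ∈ B :=
    Submodule.mem_sInf.mpr fun P hP ↦ hP.2 y hy m (Submodule.mem_sInf.mp hm P hP)
  have hmin (P : Submodule F M) (hP : P ∈ 𝓑) : B ≤ P := sInf_le hP
  refine ⟨B, hwB, ?_, ?_⟩
  · let P : Submodule F M :=
      { carrier := {m | m ∈ B ∧ ∀ x, ρ x m ∈ B}
        add_mem' := fun {a b} ha hb ↦ ⟨add_mem ha.1 hb.1, fun x ↦ by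
          rw [map_add]; exact add_mem (ha.2 x) (hb.2 x)⟩
        zero_mem' := ⟨zero_mem _, fun x ↦ by rw [map_zero]; exact zero_mem _⟩
        smul_mem' := fun a m hm ↦ ⟨B.smul_mem a hm.1, fun x ↦ by
          rw [LinearMap.map_smul_of_tower]; exact B.smul_mem a (hm.2 x)⟩ }
    have hP : B ≤ P := by
      refine hmin P ⟨⟨hwB, fun x ↦ ?_⟩, fun y hy m hm ↦ ⟨hNB y hy m hm.1, fun x ↦ ?_⟩⟩
      · have hx : x ∈ Submodule.span F
            ({x | x ∈ H} ∪ {x | ∃ q : ℚ, q ≠ 0 ∧ ⁅h, x⁆ = (q : F) • x}) := hspan ▸ trivial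
        induction hx using Submodule.span_induction with
        | mem x hx =>
          obtain hx | ⟨q, hq, hx⟩ := hx
          · obtain ⟨a, ha⟩ := hwH x hx
            exact ha ▸ B.smul_mem a hwB
          · obtain hq | hq := hq.lt_or_gt
            · exact hNB x ⟨q, hq, hx⟩ w hwB
            · exact hpos x q hq hx ▸ zero_mem _
        | zero => simp
        | add x y _ _ hx hy => rw [map_add]; exact add_mem hx hy
        | smul a x _ hx => rw [map_smul]; exact B.smul_mem a hx
      · have h1 := congrArg (fun g ↦ g m) (hρ x y)
        simp only [LinearMap.sub_apply, Module.End.mul_apply] at h1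
        rw [eq_sub_iff_add_eq] at h1
        rw [← h1]
        exact add_mem (hm.2 _) (hNB y hy _ (hm.2 x))
    exact fun x m hm ↦ (hP hm).2 x
  · let E : Submodule K M := ⨆ q ∈ {q : ℚ | q < 0}, (ρ h).eigenspace (c + (q : K))
    have hE : E ≤ ⨆ a ∈ {a : K | a ≠ c}, (ρ h).eigenspace a :=
      iSup₂_le fun q hq ↦ le_iSup₂_of_le (c + (q : K)) (by simpa using hq.ne) le_rfl
    have hNE (y : L) (hy : y ∈ N) : E ≤ E.comap (ρ y) := by
      obtain ⟨r, hr, hy⟩ := hy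
      refine iSup₂_le fun q hq m hm ↦ ?_
      have := Module.End.apply_mem_eigenspace_add hρ hy hm
      rw [add_assoc, ← Rat.cast_add] at this
      exact le_iSup₂_of_le (f := fun (q : ℚ) _ ↦ (ρ h).eigenspace (c + (q : K))) (q + r)
        (add_neg hq hr) le_rfl this
    refine (hmin (Submodule.span F {w} ⊔ E.restrictScalars F)
      ⟨Submodule.mem_sup_left (Submodule.mem_span_singleton_self w), fun y hy m hm ↦ ?_⟩).trans
      (sup_le_sup_left (fun m hm ↦ hE hm) _)
    obtain ⟨u, hu, v, hv, rfl⟩ := Submodule.mem_sup.mp hm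
    obtain ⟨a, rfl⟩ := Submodule.mem_span_singleton.mp hu
    refine Submodule.mem_sup_right ?_
    rw [map_add, LinearMap.map_smul_of_tower]
    refine add_mem (Submodule.smul_mem _ a ?_) (hNE y hy hv)
    obtain ⟨r, hr, hy⟩ := hy
    exact le_iSup₂_of_le (f := fun (q : ℚ) _ ↦ (ρ h).eigenspace (c + (q : K))) r hr le_rfl
      (Module.End.apply_mem_eigenspace_add hρ hy (Module.End.mem_eigenspace_iff.mpr hwc))

/-- An irreducible representation over an algebraically closed field `K` of a split semisimple Lie
algebra over a subfield `F` has a `K`-basis whose `F`-span is stable. -/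
lemma LieAlgebra.IsKilling.exists_basis_span_stable_of_irreducible [CharZero F]
    [IsAlgClosed K] [FiniteDimensional K M] [Nontrivial M] [FiniteDimensional F L] [IsKilling F L]
    (H : LieSubalgebra F L) [H.IsCartanSubalgebra] [LieModule.IsTriangularizable F H L]
    {ρ : L →ₗ[F] Module.End K M} (hρ : ∀ x y, ρ ⁅x, y⁆ = ρ x * ρ y - ρ y * ρ x)
    (hirr : ∀ P : Submodule K M, (∀ x, ∀ m ∈ P, ρ x m ∈ P) → P = ⊥ ∨ P = ⊤) :
    ∃ s : Set M, LinearIndependent K (fun v : s ↦ (v : M)) ∧ Submodule.span K s = ⊤ ∧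
      ∀ x, ∀ v ∈ s, ρ x v ∈ Submodule.span F s := by
  have : CharZero K := charZero_of_injective_algebraMap (algebraMap F K).injective
  obtain ⟨h, hh, hH, hspan, hsl⟩ := exists_rational_grading (F := F) H
  obtain ⟨w, c, hw0, hwc, hpos, hwH⟩ := exists_highest_weight_vector hρ hh hH hsl
  obtain ⟨B, hwB, hB, hBle⟩ := exists_stable_le_span_singleton_sup hρ hspan hwc hpos hwH
  have hwE : w ∉ ⨆ a ∈ {a : K | a ≠ c}, (ρ h).eigenspace a := fun hw ↦ hw0 <| by
    have := (Module.End.eigenspaces_iSupIndep (ρ h) c).eq_bot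
    have hmem := Submodule.mem_inf.mpr ⟨Module.End.mem_eigenspace_iff.mpr hwc, hw⟩
    exact (Submodule.eq_bot_iff _).mp this w hmem
  obtain ⟨l, hl1, hlE⟩ : ∃ l : Module.Dual K M, l w = 1 ∧
      ∀ m ∈ ⨆ a ∈ {a : K | a ≠ c}, (ρ h).eigenspace a, l m = 0 := by
    obtain ⟨f, hf, hfE⟩ := Submodule.exists_le_ker_of_notMem hwE
    refine ⟨(f w)⁻¹ • f, inv_mul_cancel₀ hf, fun m hm ↦ ?_⟩
    rw [LinearMap.smul_apply, LinearMap.mem_ker.mp (hfE hm), smul_zero]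
  have hlB (m : M) (hm : m ∈ B) : l m ∈ Set.range (algebraMap F K) := by
    obtain ⟨u, hu, v, hv, rfl⟩ := Submodule.mem_sup.mp (hBle hm)
    obtain ⟨a, rfl⟩ := Submodule.mem_span_singleton.mp hu
    refine ⟨a, ?_⟩
    rw [map_add, hlE v hv, LinearMap.map_smul_of_tower, hl1, add_zero,
      Algebra.algebraMap_eq_smul_one]
  let b := Basis.ofVectorSpace F B
  have hbB : Submodule.span F (Set.range fun i ↦ (b i : M)) = B := by
    have := congrArg (Submodule.map B.subtype) b.span_eq
    rw [Submodule.map_span, Submodule.map_top, Submodule.range_subtype, ← Set.range_comp] at this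
    exact this
  have hli : LinearIndependent K fun i ↦ (b i : M) :=
    LinearIndependent.of_stable_of_functional (S := Set.range ρ) (B := B) (l := l)
      (by simpa using hirr) (by simpa using hB) (by rintro rfl; simp at hl1) hlB
      (fun i ↦ (b i).2) (b.linearIndependent.map' B.subtype B.ker_subtype)
  refine ⟨Set.range fun i ↦ (b i : M), hli.linearIndepOn_id, ?_, ?_⟩
  · have hBspan : B ≤ (Submodule.span K (Set.range fun i ↦ (b i : M))).restrictScalars F :=
      hbB.symm.trans_le (Submodule.span_le.mpr fun m hm ↦ Submodule.subset_span hm)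
    refine (hirr _ fun x m hm ↦ ?_).resolve_left fun h ↦ hw0 ?_
    · induction hm using Submodule.span_induction with
      | mem m hm =>
        obtain ⟨i, rfl⟩ := hm
        exact hBspan (hB x _ (b i).2)
      | zero => simp
      | add u v _ _ hu hv => rw [map_add]; exact add_mem hu hv
      | smul a u _ hu => rw [map_smul]; exact Submodule.smul_mem _ a hu
    · exact (Submodule.eq_bot_iff _).mp h w (hBspan hwB)
  · rintro x _ ⟨i, rfl⟩
    rw [hbB]
    exact hB x _ (b i).2

/-- A minimal stable subspace of a representation over an algebraically closed field `K` of a split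
semisimple Lie algebra over a subfield `F` has a `K`-basis whose `F`-span is stable. -/
lemma LieAlgebra.IsKilling.exists_basis_span_stable_of_minimal [CharZero F]
    [IsAlgClosed K] [FiniteDimensional K M] [FiniteDimensional F L] [IsKilling F L]
    (H : LieSubalgebra F L) [H.IsCartanSubalgebra] [LieModule.IsTriangularizable F H L]
    {ρ : L →ₗ[F] Module.End K M} (hρ : ∀ x y, ρ ⁅x, y⁆ = ρ x * ρ y - ρ y * ρ x)
    {P : Submodule K M} (hP : ∀ x, ∀ m ∈ P, ρ x m ∈ P) (hP0 : P ≠ ⊥)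
    (hmin : ∀ Q ≤ P, (∀ x, ∀ m ∈ Q, ρ x m ∈ Q) → Q = ⊥ ∨ Q = P) :
    ∃ s : Set M, LinearIndependent K (fun v : s ↦ (v : M)) ∧ Submodule.span K s = P ∧
      ∀ x, ∀ v ∈ s, ρ x v ∈ Submodule.span F s := by
  have : Nontrivial P := P.nontrivial_iff_ne_bot.mpr hP0
  let ρP : L →ₗ[F] Module.End K P :=
    { toFun x := (ρ x).restrict (hP x)
      map_add' x y := by ext; simp
      map_smul' a x := by ext; simp }
  have hρP (x y : L) : ρP ⁅x, y⁆ = ρP x * ρP y - ρP y * ρP x := by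
    ext m
    simp [ρP, hρ]
  obtain ⟨s, hli, hspan, hs⟩ := exists_basis_span_stable_of_irreducible H hρP fun Q hQ ↦ by
    have := hmin (Q.map P.subtype) (P.map_subtype_le Q) ?_
    · refine this.imp (fun h ↦ ?_) fun h ↦ ?_
      · exact Submodule.map_injective_of_injective P.injective_subtype
          (by rw [h, Submodule.map_bot])
      · exact Submodule.map_injective_of_injective P.injective_subtype
          (by rw [h, P.map_subtype_top])
    · rintro x _ ⟨m, hm, rfl⟩
      exact ⟨_, hQ x m hm, rfl⟩
  refine ⟨P.subtype '' s, ?_, ?_, ?_⟩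
  · exact LinearIndepOn.id_image (hli.map' P.subtype P.ker_subtype)
  · rw [← Submodule.map_span, hspan, Submodule.map_top, P.range_subtype]
  · rintro x _ ⟨m, hm, rfl⟩
    have := Submodule.mem_map_of_mem (f := P.subtype.restrictScalars F) (hs x m hm)
    rwa [Submodule.map_span] at this

end Form

section BaseChange

open LieAlgebra Module

variable {F K L V : Type*} [Field F] [Field K] [Algebra F K] [AddCommGroup V] [Module F V]

/-- Contraction with a functional on the scalars commutes with base-changed endomorphisms. -/
lemma TensorProduct.lid_rTensor_baseChange (θ : Module.Dual F K) (φ : Module.End F V)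
    (w : K ⊗[F] V) : TensorProduct.lid F V (θ.rTensor V (φ.baseChange K w)) =
      φ (TensorProduct.lid F V (θ.rTensor V w)) := by
  induction w using TensorProduct.induction_on with
  | zero => simp
  | tmul a v => simp
  | add u v hu hv => simp only [map_add, hu, hv]

/-- Contractions with functionals on the scalars separate the points of a base change. -/
lemma TensorProduct.exists_lid_rTensor_ne_zero {w : K ⊗[F] V} (hw : w ≠ 0) :
    ∃ θ : Module.Dual F K, TensorProduct.lid F V (θ.rTensor V w) ≠ 0 := by
  let b := Basis.ofVectorSpace F V
  have hcoord (θ : Module.Dual F K) (i) (u : K ⊗[F] V) :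
      b.repr (TensorProduct.lid F V (θ.rTensor V u)) i = θ ((b.baseChange K).repr u i) := by
    induction u using TensorProduct.induction_on with
    | zero => simp
    | tmul a v => simp [mul_comm]
    | add u v hu hv => simp only [map_add, Finsupp.add_apply, hu, hv]
  by_contra! h
  refine hw ((b.baseChange K).ext_elem fun i ↦ ?_)
  rw [map_zero, Finsupp.zero_apply, ← Module.forall_dual_apply_eq_zero_iff F]
  intro θ
  rw [← hcoord, h, map_zero, Finsupp.zero_apply]

/-- Irreducible representations of a split semisimple Lie algebra are absolutely irreducible. -/
lemma LieAlgebra.IsKilling.eq_bot_or_eq_top_of_baseChange_stable [CharZero F] [IsAlgClosed K]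
    [LieRing L] [LieAlgebra F L] [FiniteDimensional F L] [IsKilling F L]
    (H : LieSubalgebra F L) [H.IsCartanSubalgebra] [LieModule.IsTriangularizable F H L]
    [LieRingModule L V] [LieModule F L V] [FiniteDimensional F V]
    (hirr : ∀ p : Submodule F V, (∀ x : L, ∀ v ∈ p, ⁅x, v⁆ ∈ p) → p = ⊥ ∨ p = ⊤)
    {P : Submodule K (K ⊗[F] V)}
    (hP : ∀ x : L, ∀ w ∈ P, (LieModule.toEnd F L V x).baseChange K w ∈ P) :
    P = ⊥ ∨ P = ⊤ := by
  refine or_iff_not_imp_left.mpr fun hP0 ↦ ?_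
  let ρ : L →ₗ[F] Module.End K (K ⊗[F] V) :=
    { toFun x := (LieModule.toEnd F L V x).baseChange K
      map_add' x y := by rw [map_add, LinearMap.baseChange_add]
      map_smul' a x := by rw [map_smul, LinearMap.baseChange_smul, RingHom.id_apply] }
  have hρ (x y : L) : ρ ⁅x, y⁆ = ρ x * ρ y - ρ y * ρ x := by
    simp only [ρ, LinearMap.coe_mk, AddHom.coe_mk, LieHom.map_lie, Ring.lie_def,
      LinearMap.baseChange_sub, LinearMap.baseChange_mul]
  obtain ⟨Q, ⟨hQP, hQ0, hQ⟩, hQmin⟩ := exists_minimal_of_wellFoundedLT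
    (fun Q : Submodule K (K ⊗[F] V) ↦ Q ≤ P ∧ Q ≠ ⊥ ∧ ∀ x, ∀ m ∈ Q, ρ x m ∈ Q)
    ⟨P, le_rfl, hP0, hP⟩
  obtain ⟨s, hli, hspan, hs⟩ := exists_basis_span_stable_of_minimal H hρ hQ hQ0
    fun R hR hst ↦ or_iff_not_imp_left.mpr fun hR0 ↦
      hR.antisymm (hQmin ⟨hR.trans hQP, hR0, hst⟩ hR)
  obtain ⟨w, hws, hw0⟩ : ∃ w ∈ s, w ≠ 0 := by
    by_contra! h
    exact hQ0 (by rw [← hspan, Submodule.span_eq_bot]; exact h)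
  obtain ⟨θ, hθ⟩ := TensorProduct.exists_lid_rTensor_ne_zero hw0
  let π : K ⊗[F] V →ₗ[F] V := (TensorProduct.lid F V).toLinearMap ∘ₗ θ.rTensor V
  have hπ : (Submodule.span F s).map π = ⊤ := by
    refine (hirr _ ?_).resolve_left fun h ↦ hθ ?_
    · rintro x _ ⟨m, hm, rfl⟩
      refine ⟨ρ x m, ?_, TensorProduct.lid_rTensor_baseChange θ _ m⟩
      have : Submodule.span F s ≤ (Submodule.span F s).comap ((ρ x).restrictScalars F) :=
        Submodule.span_le.mpr (hs x)
      exact this hm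
    · exact (Submodule.eq_bot_iff _).mp h _ ⟨w, Submodule.subset_span hws, rfl⟩
  have hfin : s.Finite := hli.setFinite
  have := hfin.fintype
  have : FiniteDimensional F (Submodule.span F s) := FiniteDimensional.span_of_finite F hfin
  have hV : finrank F V ≤ finrank K Q := by
    calc finrank F V = finrank F ((Submodule.span F s).map π) := by rw [hπ, finrank_top]
      _ ≤ finrank F (Submodule.span F s) := Submodule.finrank_map_le _ _
      _ ≤ s.toFinset.card := finrank_span_le_card s
      _ = finrank K Q := by rw [← hspan, finrank_span_set_eq_card hli]
  have hQ' : Q = ⊤ := by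
    refine Submodule.eq_top_of_finrank_eq (le_antisymm Q.finrank_le ?_)
    rwa [finrank_baseChange]
  rwa [hQ', top_le_iff] at hQP

variable [LieRing L] [LieAlgebra F L]

/-- A base change of a finite-dimensional Killing Lie algebra over a field is Killing. -/
instance LieAlgebra.IsKilling.baseChange [FiniteDimensional F L] [IsKilling F L] :
    IsKilling K (K ⊗[F] L) := by
  let b := finBasis F L
  obtain ⟨b', hb', -⟩ := exists_dual_family b
  have hcoord (i) (z : K ⊗[F] L) :
      (b.baseChange K).repr z i = killingForm K (K ⊗[F] L) (1 ⊗ₜ b' i) z := by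
    induction z using TensorProduct.induction_on with
    | zero => simp
    | tmul a x =>
      rw [Basis.baseChange_repr_tmul, hb', LieModule.traceForm_comm, LieModule.traceForm_baseChange]
      simp
    | add u v hu hv => simp only [map_add, Finsupp.add_apply, hu, hv]
  refine ⟨(LieSubmodule.eq_bot_iff _).mpr fun z hz ↦ (b.baseChange K).ext_elem fun i ↦ ?_⟩
  rw [hcoord, (LieIdeal.mem_killingCompl K (K ⊗[F] L) ⊤).mp hz _ (LieSubmodule.mem_top _), map_zero,
    Finsupp.zero_apply]

/-- A subspace stable under the pure tensors `1 ⊗ x` is stable under the base-changed Lie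
algebra. -/
lemma TensorProduct.lie_mem_of_forall_one_tmul {W : Type*} [AddCommGroup W] [Module K W]
    [LieRingModule (K ⊗[F] L) W] [LieModule K (K ⊗[F] L) W] {P : Submodule K W}
    (hP : ∀ x : L, ∀ m ∈ P, ⁅(1 : K) ⊗ₜ[F] x, m⁆ ∈ P) (z : K ⊗[F] L) {m : W} (hm : m ∈ P) :
    ⁅z, m⁆ ∈ P := by
  induction z using TensorProduct.induction_on with
  | zero => simp
  | tmul a x =>
    rw [← mul_one a, ← smul_eq_mul, ← TensorProduct.smul_tmul', smul_lie]
    exact P.smul_mem a (hP x m hm)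
  | add u v hu hv => rw [add_lie]; exact add_mem hu hv

/-- Every representation of the base change to an algebraically closed field `K` of a split
semisimple Lie algebra over `F` has a `K`-basis whose `F`-span is stable. -/
lemma LieAlgebra.IsKilling.exists_basis_span_stable [CharZero F] [IsAlgClosed K]
    [FiniteDimensional F L] [IsKilling F L]
    (H : LieSubalgebra F L) [H.IsCartanSubalgebra] [LieModule.IsTriangularizable F H L]
    {W : Type*} [AddCommGroup W] [Module K W] [Module F W] [IsScalarTower F K W]
    [LieRingModule (K ⊗[F] L) W] [LieModule K (K ⊗[F] L) W] [FiniteDimensional K W]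
    (N : LieSubmodule K (K ⊗[F] L) W) :
    ∃ s : Set W, LinearIndependent K (fun v : s ↦ (v : W)) ∧ Submodule.span K s = N ∧
      ∀ x : L, ∀ v ∈ s, ⁅(1 : K) ⊗ₜ[F] x, v⁆ ∈ Submodule.span F s := by
  have : CharZero K := charZero_of_injective_algebraMap (algebraMap F K).injective
  have := complementedLattice_lieSubmodule (K := K) (L := K ⊗[F] L) (M := W)
  let ρ : L →ₗ[F] Module.End K W :=
    { toFun x := LieModule.toEnd K (K ⊗[F] L) W (1 ⊗ₜ x)
      map_add' x y := by rw [TensorProduct.tmul_add, map_add]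
      map_smul' a x := by
        rw [TensorProduct.tmul_smul, ← algebraMap_smul K a, map_smul, algebraMap_smul,
          RingHom.id_apply] }
  have hρ (x y : L) : ρ ⁅x, y⁆ = ρ x * ρ y - ρ y * ρ x := by
    simp only [ρ, LinearMap.coe_mk, AddHom.coe_mk, ← Ring.lie_def, ← LieHom.map_lie]
    simp
  have := LieSubmodule.wellFoundedLT_of_isArtinian K (K ⊗[F] L) W
  induction N using WellFoundedLT.induction with
  | ind N ih =>
  obtain rfl | hN := eq_or_ne N ⊥
  · exact ⟨∅, linearIndependent_empty_type, by simp, by simp⟩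
  obtain ⟨P, hP, hPN⟩ := (eq_bot_or_exists_atom_le N).resolve_left hN
  obtain ⟨P', hP'⟩ := exists_isCompl P
  obtain ⟨s, hs, hsP, hst⟩ := exists_basis_span_stable_of_minimal H hρ (P := P.toSubmodule)
    (fun x m hm ↦ P.lie_mem hm) (by simpa using hP.1) (fun Q hQ hst ↦ by
      let Q' : LieSubmodule K (K ⊗[F] L) W :=
        { Q with lie_mem := fun {z m} hm ↦ TensorProduct.lie_mem_of_forall_one_tmul hst z hm }
      exact (hP.le_iff.mp (show Q' ≤ P from hQ)).imp (congrArg LieSubmodule.toSubmodule)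
        (congrArg LieSubmodule.toSubmodule))
  have hlt : P' ⊓ N < N := inf_le_right.lt_of_ne fun h ↦ hP.1 <| by
    rw [eq_bot_iff, ← hP'.inf_eq_bot]
    exact le_inf le_rfl (hPN.trans (inf_eq_right.mp h))
  obtain ⟨t, ht, htP, htt⟩ := ih _ hlt
  refine ⟨s ∪ t, ?_, ?_, ?_⟩
  · refine LinearIndepOn.id_union hs ht ?_
    rw [hsP, htP, LieSubmodule.disjoint_toSubmodule]
    exact hP'.disjoint.mono_right inf_le_left
  · rw [Submodule.span_union, hsP, htP, ← LieSubmodule.sup_toSubmodule]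
    congr 1
    rw [← sup_inf_assoc_of_le P' hPN, hP'.sup_eq_top, top_inf_eq]
  · rintro x v (hv | hv)
    · exact Submodule.span_mono Set.subset_union_left (hst x v hv)
    · exact Submodule.span_mono Set.subset_union_right (htt x v hv)

end BaseChange

/-- Let `F` be a subfield of `ℂ` and `𝔤` an `F`-split semisimple Lie algebra over `F`
(with a splitting Cartan subalgebra `𝔱`).  Then every finite-dimensional irreducible
`F`-representation of `𝔤` remains irreducible after base change to `ℂ` (this is the
statement `V_F(λ) ⊗_F ℂ ≅ V_ℂ(λ)` for highest weights `λ`), and consequently every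
finite-dimensional complex representation of `𝔤 ⊗_F ℂ` has an `F`-form. -/
theorem stmt_18 {F : Type*} [Field F] [Algebra F ℂ]
    {𝔤 : Type*} [LieRing 𝔤] [LieAlgebra F 𝔤] [FiniteDimensional F 𝔤]
    [LieAlgebra.IsSemisimple F 𝔤]
    (𝔱 : LieSubalgebra F 𝔤) (hCartan : 𝔱.IsCartanSubalgebra)
    (hsplit : LieModule.IsTriangularizable F 𝔱 𝔤) :
    (∀ (V : Type) (_ : AddCommGroup V) (_ : Module F V) (_ : LieRingModule 𝔤 V)
      (_ : LieModule F 𝔤 V) (_ : FiniteDimensional F V) (_ : Nontrivial V),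
      (∀ p : Submodule F V, (∀ x : 𝔤, ∀ v ∈ p, ⁅x, v⁆ ∈ p) → p = ⊥ ∨ p = ⊤) →
      (∀ P : Submodule ℂ (ℂ ⊗[F] V),
        (∀ x : 𝔤, ∀ w ∈ P, (LieModule.toEnd F 𝔤 V x).baseChange ℂ w ∈ P) →
        P = ⊥ ∨ P = ⊤)) ∧
    (∀ (W : Type) (_ : AddCommGroup W) (_ : Module ℂ W) (_ : Module F W)
      (_ : IsScalarTower F ℂ W) (_ : LieRingModule (ℂ ⊗[F] 𝔤) W)
      (_ : LieModule ℂ (ℂ ⊗[F] 𝔤) W) (_ : FiniteDimensional ℂ W),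
      ∃ V₀ : Submodule F W,
        (∀ x : 𝔤, ∀ v ∈ V₀, ⁅(1 : ℂ) ⊗ₜ[F] x, v⁆ ∈ V₀) ∧
        ∃ s : Set W, s ⊆ (V₀ : Set W) ∧
          LinearIndependent ℂ (fun v : s => (v : W)) ∧
          Submodule.span ℂ s = ⊤ ∧ Submodule.span F s = V₀) := by
  have : CharZero F :=
    (algebraMap F ℂ).charZero_iff (algebraMap F ℂ).injective |>.mpr inferInstance
  have : LieAlgebra.IsKilling F 𝔤 := inferInstance
  refine ⟨fun V _ _ _ _ _ _ hirr P hP ↦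
    LieAlgebra.IsKilling.eq_bot_or_eq_top_of_baseChange_stable 𝔱 hirr hP, fun W _ _ _ _ _ _ _ ↦ ?_⟩
  obtain ⟨s, hs, hspan, hst⟩ := LieAlgebra.IsKilling.exists_basis_span_stable (F := F) 𝔱
    (⊤ : LieSubmodule ℂ (ℂ ⊗[F] 𝔤) W)
  refine ⟨Submodule.span F s, fun x v hv ↦ ?_, s, Submodule.subset_span, hs, by simpa using hspan,
    rfl⟩
  have : Submodule.span F s ≤ (Submodule.span F s).comap
      ((LieModule.toEnd ℂ (ℂ ⊗[F] 𝔤) W (1 ⊗ₜ x)).restrictScalars F) := Submodule.span_le.mpr (hst x)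
  exact this hv
end
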